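/- arXiv:2511.10889 — 5 statements merged into one kernel-verified Lean document; each statement's English description precedes it below -/
import Mathlib

section
/- Let G be a tent with tent partition (A_0,A_1;B_0,B_1,B_2,B_3;C_1,C_2,C_3;F_2,F_3;W;Y;Z). Then: (a) if Y ≠ ∅ then some vertex of Y is simplicial in G; (b) if Z ≠ ∅ then some vertex of Z is simplicial in G; (c) every vertex of W is a universal vertex of G − (Y ∪ Z); (d) G − (W ∪ Y ∪ Z) is a thickening of T_0 or of T_1. -/
open SimpleGraph

namespace Paper2P3

variable {V : Type*}

/-- `G` contains an induced subgraph isomorphic to `H`. -/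
def ContainsInduced {V W : Type*} (G : SimpleGraph V) (H : SimpleGraph W) : Prop :=
  ∃ s : Set V, Nonempty (H ≃g G.induce s)

/-- `G` is `H`-free: no induced subgraph of `G` is isomorphic to `H`. -/
def HFree {V W : Type*} (G : SimpleGraph V) (H : SimpleGraph W) : Prop :=
  ¬ ContainsInduced G H

/-- `S` is complete to `T` in `G`. -/
def Complete (G : SimpleGraph V) (S T : Set V) : Prop :=
  ∀ a ∈ S, ∀ b ∈ T, G.Adj a b

/-- `S` is anticomplete to `T` in `G`. -/
def Anticomplete (G : SimpleGraph V) (S T : Set V) : Prop :=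
  ∀ a ∈ S, ∀ b ∈ T, ¬ G.Adj a b

/-- The closed neighborhood `N_G[v]`. -/
def closedNbhd (G : SimpleGraph V) (v : V) : Set V := insert v (G.neighborSet v)

/-- A simplicial vertex: its neighborhood is a clique. -/
def IsSimplicial (G : SimpleGraph V) (v : V) : Prop := G.IsClique (G.neighborSet v)

/-- A universal vertex: adjacent to all other vertices. -/
def IsUniversalVertex (G : SimpleGraph V) (v : V) : Prop := ∀ w, w ≠ v → G.Adj v w

/-- `G` admits a clique-cutset: a clique `C ⊊ V(G)` such that `G - C` is disconnected. -/
def HasCliqueCutset (G : SimpleGraph V) : Prop :=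
  ∃ C : Set V, G.IsClique C ∧ C ≠ Set.univ ∧ ¬ (G.induce Cᶜ).Connected

/-- The disjoint union of two copies of `P_3`, on vertices `0,1,2` and `3,4,5`. -/
def twoP3 : SimpleGraph (Fin 6) :=
  SimpleGraph.fromRel fun a b => (a, b) ∈ ([(0,1),(1,2),(3,4),(4,5)] : List (Fin 6 × Fin 6))

/-- The edgeless graph on four vertices. -/
def fourK1 : SimpleGraph (Fin 4) := ⊥

/-- `Gs` is a thickening of `G`. -/
def IsThickening {α β : Type*} (Gs : SimpleGraph β) (G : SimpleGraph α) : Prop :=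
  ∃ X : α → Set β,
    (∀ v, (X v).Nonempty) ∧
    (∀ u v : α, u ≠ v → Disjoint (X u) (X v)) ∧
    (⋃ v, X v) = Set.univ ∧
    (∀ v, Gs.IsClique (X v)) ∧
    (∀ u v : α, u ≠ v →
      (G.Adj u v → Complete Gs (X u) (X v)) ∧ (¬ G.Adj u v → Anticomplete Gs (X u) (X v)))

/-- The closed neighborhoods of the vertices of `S` form a chain under inclusion;
equivalently (for finite graphs), `S` can be ordered as `a_1, …, a_r` with
`N_G[a_r] ⊆ ⋯ ⊆ N_G[a_1]`. -/
def ChainClosedNbhd (G : SimpleGraph V) (S : Set V) : Prop :=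
  ∀ a ∈ S, ∀ b ∈ S, closedNbhd G a ⊆ closedNbhd G b ∨ closedNbhd G b ⊆ closedNbhd G a

/-- `A` can be partitioned into cliques, pairwise anticomplete to each other. -/
def CliquesPartition (G : SimpleGraph V) (A : Set V) : Prop :=
  ∃ (ℓ : ℕ) (P : Fin ℓ → Set V),
    (∀ i, G.IsClique (P i)) ∧
    (∀ i j, i ≠ j → Disjoint (P i) (P j)) ∧
    (∀ i j, i ≠ j → Anticomplete G (P i) (P j)) ∧
    (⋃ i, P i) = A

/-- `A` can be partitioned into nonempty cliques, pairwise anticomplete to each other. -/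
def NonemptyCliquesPartition (G : SimpleGraph V) (A : Set V) : Prop :=
  ∃ (ℓ : ℕ) (P : Fin ℓ → Set V),
    (∀ i, (P i).Nonempty) ∧
    (∀ i, G.IsClique (P i)) ∧
    (∀ i j, i ≠ j → Disjoint (P i) (P j)) ∧
    (∀ i j, i ≠ j → Anticomplete G (P i) (P j)) ∧
    (⋃ i, P i) = A

/-- `A` can be partitioned into nonempty cliques, pairwise anticomplete to each other,
each of which can be ordered so that the closed neighborhoods form a decreasing chain. -/
def OrderedCliquesPartition (G : SimpleGraph V) (A : Set V) : Prop :=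
  ∃ (ℓ : ℕ) (P : Fin ℓ → Set V),
    (∀ i, (P i).Nonempty) ∧
    (∀ i, G.IsClique (P i)) ∧
    (∀ i j, i ≠ j → Disjoint (P i) (P j)) ∧
    (∀ i j, i ≠ j → Anticomplete G (P i) (P j)) ∧
    (⋃ i, P i) = A ∧
    (∀ i, ChainClosedNbhd G (P i))

/-- `(X_0,…,X_6; Y_0,…,Y_6; Z_0,…,Z_6; W)` is a special partition of the induced
subgraph of `G` on `S` (indices in `ℤ_7`). -/
def IsSpecialPartitionOn (G : SimpleGraph V) (S : Set V)
    (X Y Z : ZMod 7 → Set V) (W : Set V) : Prop :=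
  -- the sets are pairwise disjoint and their union is `S`
  (∀ i j, i ≠ j → Disjoint (X i) (X j)) ∧
  (∀ i j, i ≠ j → Disjoint (Y i) (Y j)) ∧
  (∀ i j, i ≠ j → Disjoint (Z i) (Z j)) ∧
  (∀ i j, Disjoint (X i) (Y j)) ∧
  (∀ i j, Disjoint (X i) (Z j)) ∧
  (∀ i j, Disjoint (Y i) (Z j)) ∧
  (∀ i, Disjoint (X i) W) ∧ (∀ i, Disjoint (Y i) W) ∧ (∀ i, Disjoint (Z i) W) ∧
  ((⋃ i, X i) ∪ (⋃ i, Y i) ∪ (⋃ i, Z i) ∪ W = S) ∧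
  -- all the sets are cliques
  (∀ i, G.IsClique (X i)) ∧ (∀ i, G.IsClique (Y i)) ∧ (∀ i, G.IsClique (Z i)) ∧
  G.IsClique W ∧
  -- (a)
  (∀ i, (X i).Nonempty) ∧
  -- (b)
  (∀ i, Complete G (X i) (X (i - 1)) ∧ Complete G (X i) (X (i + 1)) ∧
    Anticomplete G (X i) (X (i + 2)) ∧ Anticomplete G (X i) (X (i + 3)) ∧
    Anticomplete G (X i) (X (i + 4)) ∧ Anticomplete G (X i) (X (i + 5))) ∧
  -- (c)
  (∀ i, Complete G (X i) (Y i) ∧ Complete G (X i) (Y (i + 3)) ∧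
    Complete G (X i) (Y (i + 6)) ∧ Complete G (X i) (Z i) ∧
    Complete G (X i) (Z (i + 3)) ∧ Complete G (X i) (Z (i + 4)) ∧
    Complete G (X i) (Z (i + 5)) ∧ Complete G (X i) (Z (i + 6)) ∧
    Complete G (X i) W ∧
    Anticomplete G (X i) (Y (i + 1)) ∧ Anticomplete G (X i) (Y (i + 2)) ∧
    Anticomplete G (X i) (Y (i + 4)) ∧ Anticomplete G (X i) (Y (i + 5)) ∧
    Anticomplete G (X i) (Z (i + 1)) ∧ Anticomplete G (X i) (Z (i + 2))) ∧
  -- (d)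
  (∀ i, (Y i).Nonempty →
    (Y (i + 1) = ∅ ∧ Y (i + 2) = ∅ ∧ Y (i + 5) = ∅ ∧ Y (i + 6) = ∅ ∧
      Z (i + 5) = ∅ ∧ Z (i + 6) = ∅) ∧ (Y (i + 3) = ∅ ∨ Y (i + 4) = ∅)) ∧
  -- (e)
  (∀ i, (Z i).Nonempty → Z (i + 2) = ∅ ∧ Z (i + 5) = ∅) ∧
  -- (f)
  (∀ i, Complete G (Y i) (Y (i + 3)) ∧ Complete G (Y i) (Y (i + 4)) ∧
    Complete G (Y i) (Z i) ∧ Complete G (Y i) (Z (i + 1)) ∧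
    Complete G (Y i) (Z (i + 3)) ∧ Complete G (Y i) (Z (i + 4)) ∧
    Complete G (Y i) W ∧ Anticomplete G (Y i) (Z (i + 2))) ∧
  -- (g)
  (∀ i, Complete G (Z i) (Z (i + 1)) ∧ Complete G (Z i) (Z (i + 3)) ∧
    Complete G (Z i) (Z (i + 4)) ∧ Complete G (Z i) (Z (i + 6)) ∧ Complete G (Z i) W)

/-- `G` admits a special partition. -/
def AdmitsSpecialPartition (G : SimpleGraph V) : Prop :=
  ∃ (X Y Z : ZMod 7 → Set V) (W : Set V), IsSpecialPartitionOn G Set.univ X Y Z W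

/-- `G` is a 7-saucer. -/
def IsSevenSaucer (G : SimpleGraph V) : Prop :=
  ∃ (X Y Z : ZMod 7 → Set V) (W A : Set V),
    IsSpecialPartitionOn G Aᶜ X Y Z W ∧
    (∀ i, Anticomplete G A (X i)) ∧
    (∀ i, Anticomplete G A (Y i) ∨ Z (i + 2) = ∅) ∧
    (A = ∅ ∨ OrderedCliquesPartition G A)
/-- The graph `M_0`: vertices `0,…,6` are `x_0,…,x_6` (a 7-cycle), `7 = y_0`,
`8 = y_3`, `9 = z_0`, `10 = z_3`, `11 = z_4`. -/
def M0 : SimpleGraph (Fin 12) :=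
  SimpleGraph.fromRel fun a b => (a, b) ∈
    ([(0,1),(1,2),(2,3),(3,4),(4,5),(5,6),(6,0),
      (7,0),(7,1),(7,4),
      (8,3),(8,4),(8,0),
      (9,0),(9,1),(9,2),(9,3),(9,4),
      (10,3),(10,4),(10,5),(10,6),(10,0),
      (11,4),(11,5),(11,6),(11,0),(11,1),
      (7,8),(7,9),(7,10),(7,11),(8,9),(8,10),(8,11),(9,10),(9,11),(10,11)] :
      List (Fin 12 × Fin 12))

/-- The graph `M_1`: vertices `0,…,6` are `x_0,…,x_6` (a 7-cycle), `7 = y_0`, `8 = z_2`. -/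
def M1 : SimpleGraph (Fin 9) :=
  SimpleGraph.fromRel fun a b => (a, b) ∈
    ([(0,1),(1,2),(2,3),(3,4),(4,5),(5,6),(6,0),
      (7,0),(7,1),(7,4),
      (8,2),(8,3),(8,4),(8,5),(8,6)] : List (Fin 9 × Fin 9))

/-- The graph `M_2`: `M_1` plus the vertex `9 = z_1`. -/
def M2 : SimpleGraph (Fin 10) :=
  SimpleGraph.fromRel fun a b => (a, b) ∈
    ([(0,1),(1,2),(2,3),(3,4),(4,5),(5,6),(6,0),
      (7,0),(7,1),(7,4),
      (8,2),(8,3),(8,4),(8,5),(8,6),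
      (9,1),(9,2),(9,3),(9,4),(9,5),(9,7),(9,8)] : List (Fin 10 × Fin 10))

/-- The graph `M_3`: `M_1` plus the vertex `9 = z_3`. -/
def M3 : SimpleGraph (Fin 10) :=
  SimpleGraph.fromRel fun a b => (a, b) ∈
    ([(0,1),(1,2),(2,3),(3,4),(4,5),(5,6),(6,0),
      (7,0),(7,1),(7,4),
      (8,2),(8,3),(8,4),(8,5),(8,6),
      (9,3),(9,4),(9,5),(9,6),(9,0),(9,7),(9,8)] : List (Fin 10 × Fin 10))

/-- The set `{y_0, y_3, z_0, z_3, z_4}` of vertices of `M_0`. -/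
def M0Extra : Set (Fin 12) := {7, 8, 9, 10, 11}

/-- `H` is a thickening of a graph in the family `ℳ`, which consists of
`M_1`, `M_2`, `M_3`, and all graphs `M_0 - S` for `S ⊆ {y_0,y_3,z_0,z_3,z_4}`. -/
def IsThickeningOfM {β : Type*} (H : SimpleGraph β) : Prop :=
  IsThickening H M1 ∨ IsThickening H M2 ∨ IsThickening H M3 ∨
  ∃ S : Set (Fin 12), S ⊆ M0Extra ∧ IsThickening H (M0.induce Sᶜ)
/-- The graph `T_0`: vertices `0 = a_0`, `1 = a_1`, `2 = b_0`, `3 = b_1`, `4 = b_2`,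
`5 = b_3`, `6 = c_1`, `7 = c_2`, `8 = c_3`. -/
def T0 : SimpleGraph (Fin 9) :=
  SimpleGraph.fromRel fun a b => (a, b) ∈
    ([(0,1),(0,2),(0,4),(0,5),(1,3),(1,4),(1,5),
      (2,6),(3,6),(4,7),(5,8),(6,7),(6,8),(7,8)] : List (Fin 9 × Fin 9))

/-- The graph `T_1`: `T_0` plus the vertex `9 = f_3`, adjacent to
`a_0,a_1,b_0,b_1,b_2,c_1,c_2` and nonadjacent to `b_3,c_3`. -/
def T1 : SimpleGraph (Fin 10) :=
  SimpleGraph.fromRel fun a b => (a, b) ∈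
    ([(0,1),(0,2),(0,4),(0,5),(1,3),(1,4),(1,5),
      (2,6),(3,6),(4,7),(5,8),(6,7),(6,8),(7,8),
      (9,0),(9,1),(9,2),(9,3),(9,4),(9,6),(9,7)] : List (Fin 10 × Fin 10))
/-- `(A_0,A_1;B_0,B_1,B_2,B_3;C_1,C_2,C_3;F_2,F_3;W;Y;Z)` is a tent partition of `G`. -/
def IsTentPartition (G : SimpleGraph V)
    (A0 A1 B0 B1 B2 B3 C1 C2 C3 F2 F3 W Y Z : Set V) : Prop :=
  let P : Fin 14 → Set V := ![A0, A1, B0, B1, B2, B3, C1, C2, C3, F2, F3, W, Y, Z]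
  -- the fourteen sets form a partition of the vertex set
  (∀ i j : Fin 14, i ≠ j → Disjoint (P i) (P j)) ∧
  (⋃ i, P i) = Set.univ ∧
  -- A_0,A_1,B_0,B_1,B_2,B_3,C_1,C_2,C_3 are nonempty cliques
  (A0.Nonempty ∧ A1.Nonempty ∧ B0.Nonempty ∧ B1.Nonempty ∧ B2.Nonempty ∧
    B3.Nonempty ∧ C1.Nonempty ∧ C2.Nonempty ∧ C3.Nonempty) ∧
  (G.IsClique A0 ∧ G.IsClique A1 ∧ G.IsClique B0 ∧ G.IsClique B1 ∧ G.IsClique B2 ∧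
    G.IsClique B3 ∧ G.IsClique C1 ∧ G.IsClique C2 ∧ G.IsClique C3) ∧
  -- F_2, F_3, Y are cliques, and at most one of them is nonempty
  (G.IsClique F2 ∧ G.IsClique F3 ∧ G.IsClique Y) ∧
  ((F2 = ∅ ∧ F3 = ∅) ∨ (F2 = ∅ ∧ Y = ∅) ∨ (F3 = ∅ ∧ Y = ∅)) ∧
  -- W is a (possibly empty) clique
  G.IsClique W ∧
  Complete G A0 A1 ∧
  (Complete G A0 B0 ∧ Complete G A0 B2 ∧ Complete G A0 B3 ∧
    Anticomplete G A0 B1 ∧ Anticomplete G A0 C1 ∧ Anticomplete G A0 C2 ∧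
    Anticomplete G A0 C3) ∧
  (Complete G A1 B1 ∧ Complete G A1 B2 ∧ Complete G A1 B3 ∧
    Anticomplete G A1 B0 ∧ Anticomplete G A1 C1 ∧ Anticomplete G A1 C2 ∧
    Anticomplete G A1 C3) ∧
  (Anticomplete G B0 B1 ∧ Anticomplete G B0 B2 ∧ Anticomplete G B0 B3 ∧
    Anticomplete G B1 B2 ∧ Anticomplete G B1 B3 ∧ Anticomplete G B2 B3) ∧
  (Complete G C1 C2 ∧ Complete G C1 C3 ∧ Complete G C2 C3) ∧
  (Complete G C1 B0 ∧ Complete G C1 B1 ∧ Anticomplete G C1 B2 ∧ Anticomplete G C1 B3) ∧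
  (Complete G C2 B2 ∧ Anticomplete G C2 B0 ∧ Anticomplete G C2 B1 ∧
    Anticomplete G C2 B3) ∧
  (Complete G C3 B3 ∧ Anticomplete G C3 B0 ∧ Anticomplete G C3 B1 ∧
    Anticomplete G C3 B2) ∧
  (Complete G F2 A0 ∧ Complete G F2 A1 ∧ Complete G F2 B0 ∧ Complete G F2 B1 ∧
    Complete G F2 B3 ∧ Complete G F2 C1 ∧ Complete G F2 C3 ∧
    Anticomplete G F2 B2 ∧ Anticomplete G F2 C2) ∧
  (Complete G F3 A0 ∧ Complete G F3 A1 ∧ Complete G F3 B0 ∧ Complete G F3 B1 ∧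
    Complete G F3 B2 ∧ Complete G F3 C1 ∧ Complete G F3 C2 ∧
    Anticomplete G F3 B3 ∧ Anticomplete G F3 C3) ∧
  (Complete G W A0 ∧ Complete G W A1 ∧ Complete G W B0 ∧ Complete G W B1 ∧
    Complete G W B2 ∧ Complete G W B3 ∧ Complete G W C1 ∧ Complete G W C2 ∧
    Complete G W C3 ∧ Complete G W F2 ∧ Complete G W F3) ∧
  (Complete G Y C2 ∧ Complete G Y C3 ∧
    Anticomplete G Y A0 ∧ Anticomplete G Y A1 ∧ Anticomplete G Y B0 ∧
    Anticomplete G Y B1 ∧ Anticomplete G Y B2 ∧ Anticomplete G Y B3 ∧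
    Anticomplete G Y C1) ∧
  (Anticomplete G Z A0 ∧ Anticomplete G Z A1 ∧ Anticomplete G Z B0 ∧
    Anticomplete G Z B1 ∧ Anticomplete G Z B2 ∧ Anticomplete G Z B3 ∧
    Anticomplete G Z C1 ∧ Anticomplete G Z C2 ∧ Anticomplete G Z C3 ∧
    Anticomplete G Z Y) ∧
  -- Y can be ordered so that the closed neighborhoods form a chain
  ChainClosedNbhd G Y ∧
  -- Z is empty or can be partitioned into nonempty cliques, pairwise anticomplete,
  -- each ordered so that the closed neighborhoods form a chain
  (Z = ∅ ∨ OrderedCliquesPartition G Z)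

/-- `G` is a tent. -/
def IsTent (G : SimpleGraph V) : Prop :=
  ∃ A0 A1 B0 B1 B2 B3 C1 C2 C3 F2 F3 W Y Z : Set V,
    IsTentPartition G A0 A1 B0 B1 B2 B3 C1 C2 C3 F2 F3 W Y Z

theorem Complete.symm {G : SimpleGraph V} {S T : Set V} (h : Complete G S T) :
    Complete G T S :=
  fun a ha b hb => (h b hb a ha).symm

theorem Anticomplete.symm {G : SimpleGraph V} {S T : Set V} (h : Anticomplete G S T) :
    Anticomplete G T S :=
  fun a ha b hb hab => h b hb a ha hab.symm

theorem _root_.SimpleGraph.IsClique.union_of_complete {G : SimpleGraph V} {S T : Set V}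
    (hS : G.IsClique S) (hT : G.IsClique T) (h : Complete G S T) : G.IsClique (S ∪ T) := by
  rintro a (ha | ha) b (hb | hb) hab
  exacts [hS ha hb hab, h a ha b hb, h.symm a ha b hb, hT ha hb hab]

/-- A finite nonempty set with chain-ordered closed neighborhoods has a vertex with smallest
closed neighborhood. -/
theorem ChainClosedNbhd.exists_min [Finite V] {G : SimpleGraph V} {S : Set V}
    (h : ChainClosedNbhd G S) (hS : S.Nonempty) :
    ∃ a ∈ S, ∀ b ∈ S, closedNbhd G a ⊆ closedNbhd G b := by
  obtain ⟨a, ha, hmin⟩ := Set.exists_min_image S (fun v => (closedNbhd G v).ncard)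
    S.toFinite hS
  refine ⟨a, ha, fun b hb => (h a ha b hb).elim id fun hba => ?_⟩
  exact (Set.eq_of_subset_of_ncard_le hba (hmin b hb) (Set.toFinite _)).ge

/-- If `T` is a clique, and `a` is a vertex whose neighbors all lie in `S ∪ T` and whose closed
neighborhood is contained in that of every vertex of `S`, then `a` is simplicial. -/
theorem isSimplicial_of_closedNbhd_subset {G : SimpleGraph V} {S T : Set V} {a : V}
    (hT : G.IsClique T)
    (hmin : ∀ b ∈ S, closedNbhd G a ⊆ closedNbhd G b)
    (hN : ∀ v, G.Adj a v → v ∈ S ∨ v ∈ T) : IsSimplicial G a := by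
  have key : ∀ u v, u ∈ S → G.Adj a v → u ≠ v → G.Adj u v := by
    intro u v hu hv huv
    rcases hmin u hu (Or.inr hv) with h | h
    · exact absurd h.symm huv
    · exact h
  intro u hu v hv huv
  rcases hN u hu with hu' | hu'
  · exact key u v hu' hv huv
  · rcases hN v hv with hv' | hv'
    · exact (key v u hv' hu huv.symm).symm
    · exact hT hu' hv' huv

/-- A clique partition of `S` indexed by the vertices of `H`, with the adjacencies of `H`,
shows that the subgraph induced on `S` is a thickening of `H`. -/
theorem isThickening_induce {α : Type*} [LinearOrder α] {G : SimpleGraph V} {H : SimpleGraph α}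
    {S : Set V} (X : α → Set V) (hne : ∀ v, (X v).Nonempty)
    (hdisj : ∀ u v, u ≠ v → Disjoint (X u) (X v)) (hunion : ⋃ v, X v = S)
    (hclique : ∀ v, G.IsClique (X v))
    (hadj : ∀ u v, u < v →
      (H.Adj u v → Complete G (X u) (X v)) ∧ (¬ H.Adj u v → Anticomplete G (X u) (X v))) :
    IsThickening (G.induce S) H := by
  have hadj' : ∀ u v, u ≠ v →
      (H.Adj u v → Complete G (X u) (X v)) ∧ (¬ H.Adj u v → Anticomplete G (X u) (X v)) := by
    intro u v huv
    rcases lt_or_gt_of_ne huv with hlt | hlt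
    · exact hadj u v hlt
    · exact ⟨fun h => ((hadj v u hlt).1 h.symm).symm,
        fun h => ((hadj v u hlt).2 fun h' => h h'.symm).symm⟩
  refine ⟨fun v => Subtype.val ⁻¹' X v, fun v => ?_, fun u v huv => (hdisj u v huv).preimage _,
    ?_, fun v => ?_, fun u v huv => ⟨fun h => ?_, fun h => ?_⟩⟩
  · obtain ⟨x, hx⟩ := hne v
    exact ⟨⟨x, hunion ▸ Set.mem_iUnion_of_mem v hx⟩, hx⟩
  · rw [← Set.preimage_iUnion, hunion]
    exact Subtype.coe_preimage_self S
  · exact fun a ha b hb hab => hclique v ha hb fun h => hab (Subtype.ext h)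
  · exact fun a ha b hb => (hadj' u v huv).1 h a ha b hb
  · exact fun a ha b hb => (hadj' u v huv).2 h a ha b hb

/-- Exchanging the indices `2` and `3` preserves tent partitions. -/
theorem IsTentPartition.swap {G : SimpleGraph V}
    {A0 A1 B0 B1 B2 B3 C1 C2 C3 F2 F3 W Y Z : Set V}
    (h : IsTentPartition G A0 A1 B0 B1 B2 B3 C1 C2 C3 F2 F3 W Y Z) :
    IsTentPartition G A0 A1 B0 B1 B3 B2 C1 C3 C2 F3 F2 W Y Z := by
  obtain ⟨hdisj, hunion, ⟨n1, n2, n3, n4, n5, n6, n7, n8, n9⟩,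
    ⟨k1, k2, k3, k4, k5, k6, k7, k8, k9⟩, ⟨kF2, kF3, kY⟩, hempty, kW, hA01,
    ⟨a1, a2, a3, a4, a5, a6, a7⟩, ⟨a1', a2', a3', a4', a5', a6', a7'⟩,
    ⟨b1, b2, b3, b4, b5, b6⟩, ⟨c1, c2, c3⟩, ⟨d1, d2, d3, d4⟩, ⟨e1, e2, e3, e4⟩,
    ⟨f1, f2, f3, f4⟩, hF2, hF3, ⟨w1, w2, w3, w4, w5, w6, w7, w8, w9, w10, w11⟩,
    ⟨y1, y2, y3, y4, y5, y6, y7, y8, y9⟩, ⟨z1, z2, z3, z4, z5, z6, z7, z8, z9, z10⟩, hY, hZ⟩ := h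
  let σ : Equiv.Perm (Fin 14) := Equiv.swap 4 5 * Equiv.swap 7 8 * Equiv.swap 9 10
  have hσ : ![A0, A1, B0, B1, B3, B2, C1, C3, C2, F3, F2, W, Y, Z] =
      ![A0, A1, B0, B1, B2, B3, C1, C2, C3, F2, F3, W, Y, Z] ∘ σ := by
    funext i
    fin_cases i <;> rfl
  refine ⟨?_, ?_, ⟨n1, n2, n3, n4, n6, n5, n7, n9, n8⟩,
    ⟨k1, k2, k3, k4, k6, k5, k7, k9, k8⟩, ⟨kF3, kF2, kY⟩, by tauto, kW, hA01,
    ⟨a1, a3, a2, a4, a5, a7, a6⟩, ⟨a1', a3', a2', a4', a5', a7', a6'⟩,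
    ⟨b1, b3, b2, b5, b4, b6.symm⟩, ⟨c2, c1, c3.symm⟩, ⟨d1, d2, d4, d3⟩, ⟨f1, f2, f3, f4⟩,
    ⟨e1, e2, e3, e4⟩, hF3, hF2, ⟨w1, w2, w3, w4, w6, w5, w7, w9, w8, w11, w10⟩,
    ⟨y2, y1, y3, y4, y5, y6, y8, y7, y9⟩, ⟨z1, z2, z3, z4, z6, z5, z7, z9, z8, z10⟩, hY, hZ⟩
  · rw [hσ]
    exact fun i j hij => hdisj _ _ (σ.injective.ne hij)
  · rw [hσ]
    exact (σ.surjective.iUnion_comp _).trans hunion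

/-- Every vertex lies in one of the fourteen parts of a tent partition. -/
theorem IsTentPartition.mem_part {G : SimpleGraph V}
    {A0 A1 B0 B1 B2 B3 C1 C2 C3 F2 F3 W Y Z : Set V}
    (h : IsTentPartition G A0 A1 B0 B1 B2 B3 C1 C2 C3 F2 F3 W Y Z) (v : V) :
    v ∈ A0 ∨ v ∈ A1 ∨ v ∈ B0 ∨ v ∈ B1 ∨ v ∈ B2 ∨ v ∈ B3 ∨ v ∈ C1 ∨ v ∈ C2 ∨ v ∈ C3 ∨
      v ∈ F2 ∨ v ∈ F3 ∨ v ∈ W ∨ v ∈ Y ∨ v ∈ Z := by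
  have hv : v ∈ ⋃ i, ![A0, A1, B0, B1, B2, B3, C1, C2, C3, F2, F3, W, Y, Z] i :=
    h.2.1 ▸ Set.mem_univ v
  simpa [Fin.exists_fin_succ] using hv

/-- The parts of a tent partition selected by an index map `e` cover the complement of
`W ∪ Y ∪ Z` if `e` avoids the indices of `W`, `Y` and `Z` and reaches those of
all other nonempty parts. -/
theorem IsTentPartition.iUnion_comp_eq {G : SimpleGraph V}
    {A0 A1 B0 B1 B2 B3 C1 C2 C3 F2 F3 W Y Z : Set V}
    (h : IsTentPartition G A0 A1 B0 B1 B2 B3 C1 C2 C3 F2 F3 W Y Z) {n : ℕ} (e : Fin n → Fin 14)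
    (hlt : ∀ i, e i < 11)
    (hcover : ∀ j < 11, ![A0, A1, B0, B1, B2, B3, C1, C2, C3, F2, F3, W, Y, Z] j = ∅ ∨
      ∃ i, e i = j) :
    ⋃ i, ![A0, A1, B0, B1, B2, B3, C1, C2, C3, F2, F3, W, Y, Z] (e i) = (W ∪ Y ∪ Z)ᶜ := by
  obtain ⟨hdisj, hunion, -⟩ := h
  generalize hP : ![A0, A1, B0, B1, B2, B3, C1, C2, C3, F2, F3, W, Y, Z] = P at *
  have hW : P 11 = W := by rw [← hP]; rfl
  have hY : P 12 = Y := by rw [← hP]; rfl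
  have hZ : P 13 = Z := by rw [← hP]; rfl
  ext v
  rw [Set.mem_iUnion, Set.mem_compl_iff, ← hW, ← hY, ← hZ]
  constructor
  · rintro ⟨i, hi⟩ ((hv | hv) | hv) <;>
      exact Set.disjoint_left.1 (hdisj _ _ (ne_of_lt ((hlt i).trans_le (by decide)))) hi hv
  · intro hv
    obtain ⟨j, hj⟩ := Set.mem_iUnion.1 (hunion ▸ Set.mem_univ v : v ∈ ⋃ i, P i)
    by_cases hj' : j < 11
    · rcases hcover j hj' with h0 | ⟨i, rfl⟩
      · exact absurd (h0 ▸ hj) (Set.notMem_empty v)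
      · exact ⟨i, hj⟩
    · have : j = 11 ∨ j = 12 ∨ j = 13 := by omega
      rcases this with rfl | rfl | rfl
      · exact absurd (Or.inl (Or.inl hj)) hv
      · exact absurd (Or.inl (Or.inr hj)) hv
      · exact absurd (Or.inr hj) hv

/-- If `F_2` and `F_3` are empty, then `G - (W ∪ Y ∪ Z)` is a thickening of `T_0`. -/
theorem IsTentPartition.isThickening_T0 {G : SimpleGraph V}
    {A0 A1 B0 B1 B2 B3 C1 C2 C3 F2 F3 W Y Z : Set V}
    (h : IsTentPartition G A0 A1 B0 B1 B2 B3 C1 C2 C3 F2 F3 W Y Z) (hF2 : F2 = ∅)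
    (hF3 : F3 = ∅) :
    IsThickening (G.induce (W ∪ Y ∪ Z)ᶜ) T0 := by
  let e : Fin 9 → Fin 14 := ![0, 1, 2, 3, 4, 5, 6, 7, 8]
  have hinj : Function.Injective e := by decide
  refine isThickening_induce
    (fun i => ![A0, A1, B0, B1, B2, B3, C1, C2, C3, F2, F3, W, Y, Z] (e i))
    ?_ (fun u v huv => h.1 _ _ (hinj.ne huv)) (h.iUnion_comp_eq e (by decide) ?_) ?_ ?_
  · obtain ⟨-, -, ⟨n1, n2, n3, n4, n5, n6, n7, n8, n9⟩, -⟩ := h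
    intro v
    fin_cases v <;> assumption
  · intro j hj
    fin_cases j
    all_goals first
      | exact Or.inl ‹_›
      | exact Or.inr (by decide)
      | exact absurd hj (by decide)
  · obtain ⟨-, -, -, ⟨k1, k2, k3, k4, k5, k6, k7, k8, k9⟩, -⟩ := h
    intro v
    fin_cases v <;> assumption
  · obtain ⟨-, -, -, -, -, -, -, hA01, ⟨a1, a2, a3, a4, a5, a6, a7⟩,
      ⟨a1', a2', a3', a4', a5', a6', a7'⟩, ⟨b1, b2, b3, b4, b5, b6⟩, ⟨c1, c2, c3⟩,
      ⟨d1, d2, d3, d4⟩, ⟨e1, e2, e3, e4⟩, ⟨f1, f2, f3, f4⟩, -⟩ := h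
    intro u v huv
    fin_cases u <;> fin_cases v
    all_goals first
      | exact absurd huv (by decide)
      | simp [e, T0]
        with_reducible first
          | assumption
          | exact Complete.symm ‹_›
          | exact Anticomplete.symm ‹_›

/-- If `F_2` is empty and `F_3` is not, then `G - (W ∪ Y ∪ Z)` is a thickening of `T_1`. -/
theorem IsTentPartition.isThickening_T1 {G : SimpleGraph V}
    {A0 A1 B0 B1 B2 B3 C1 C2 C3 F2 F3 W Y Z : Set V}
    (h : IsTentPartition G A0 A1 B0 B1 B2 B3 C1 C2 C3 F2 F3 W Y Z) (hF2 : F2 = ∅)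
    (hF3 : F3.Nonempty) :
    IsThickening (G.induce (W ∪ Y ∪ Z)ᶜ) T1 := by
  let e : Fin 10 → Fin 14 := ![0, 1, 2, 3, 4, 5, 6, 7, 8, 10]
  have hinj : Function.Injective e := by decide
  refine isThickening_induce
    (fun i => ![A0, A1, B0, B1, B2, B3, C1, C2, C3, F2, F3, W, Y, Z] (e i))
    ?_ (fun u v huv => h.1 _ _ (hinj.ne huv)) (h.iUnion_comp_eq e (by decide) ?_) ?_ ?_
  · obtain ⟨-, -, ⟨n1, n2, n3, n4, n5, n6, n7, n8, n9⟩, -⟩ := h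
    intro v
    fin_cases v <;> assumption
  · intro j hj
    fin_cases j
    all_goals first
      | exact Or.inl ‹_›
      | exact Or.inr (by decide)
      | exact absurd hj (by decide)
  · obtain ⟨-, -, -, ⟨k1, k2, k3, k4, k5, k6, k7, k8, k9⟩, ⟨-, kF3, -⟩, -⟩ := h
    intro v
    fin_cases v <;> assumption
  · obtain ⟨-, -, -, -, -, -, -, hA01, ⟨a1, a2, a3, a4, a5, a6, a7⟩,
      ⟨a1', a2', a3', a4', a5', a6', a7'⟩, ⟨b1, b2, b3, b4, b5, b6⟩, ⟨c1, c2, c3⟩,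
      ⟨d1, d2, d3, d4⟩, ⟨e1, e2, e3, e4⟩, ⟨f1, f2, f3, f4⟩, -,
      ⟨g1, g2, g3, g4, g5, g6, g7, g8, g9⟩, -⟩ := h
    intro u v huv
    fin_cases u <;> fin_cases v
    all_goals first
      | exact absurd huv (by decide)
      | simp [e, T1]
        with_reducible first
          | assumption
          | exact Complete.symm ‹_›
          | exact Anticomplete.symm ‹_›

/-- Properties of a tent partition: (a) if `Y ≠ ∅` then some vertex of `Y` is
simplicial; (b) if `Z ≠ ∅` then some vertex of `Z` is simplicial; (c) every vertex of
`W` is a universal vertex of `G - (Y ∪ Z)`; (d) `G - (W ∪ Y ∪ Z)` is a thickening of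
`T_0` or of `T_1`. -/
theorem statement12 {V : Type*} [Fintype V] (G : SimpleGraph V)
    (A0 A1 B0 B1 B2 B3 C1 C2 C3 F2 F3 W Y Z : Set V)
    (h : IsTentPartition G A0 A1 B0 B1 B2 B3 C1 C2 C3 F2 F3 W Y Z) :
    (Y ≠ ∅ → ∃ y ∈ Y, IsSimplicial G y) ∧
    (Z ≠ ∅ → ∃ z ∈ Z, IsSimplicial G z) ∧
    (∀ w ∈ W, ∀ u ∉ Y ∪ Z, u ≠ w → G.Adj w u) ∧
    (IsThickening (G.induce (W ∪ Y ∪ Z)ᶜ) T0 ∨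
      IsThickening (G.induce (W ∪ Y ∪ Z)ᶜ) T1) := by
  have hpart := h.mem_part
  have h' := h
  obtain ⟨-, -, -, ⟨-, -, -, -, -, -, -, k8, k9⟩, ⟨kF2, kF3, -⟩, hempty, kW, -, -, -, -,
    ⟨-, -, c3⟩, -, -, -, -, -, ⟨w1, w2, w3, w4, w5, w6, w7, w8, w9, w10, w11⟩,
    ⟨-, -, y3, y4, y5, y6, y7, y8, y9⟩, ⟨z1, z2, z3, z4, z5, z6, z7, z8, z9, z10⟩, hY, hZ⟩ := h
  refine ⟨fun hne => ?_, fun hne => ?_, fun w hw u hu huw => ?_, ?_⟩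
  · obtain ⟨rfl, rfl⟩ : F2 = ∅ ∧ F3 = ∅ := by tauto
    obtain ⟨y, hy, hmin⟩ := hY.exists_min (Set.nonempty_iff_ne_empty.2 hne)
    refine ⟨y, hy, isSimplicial_of_closedNbhd_subset (T := W ∪ (C2 ∪ C3)) ?_ hmin ?_⟩
    · refine kW.union_of_complete (k8.union_of_complete k9 c3) ?_
      rintro a ha b (hb | hb)
      exacts [w8 a ha b hb, w9 a ha b hb]
    · intro v hv
      rcases hpart v with k | k | k | k | k | k | k | k | k | k | k | k | k | k
      exacts [absurd hv (y3 y hy v k), absurd hv (y4 y hy v k), absurd hv (y5 y hy v k),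
        absurd hv (y6 y hy v k), absurd hv (y7 y hy v k), absurd hv (y8 y hy v k),
        absurd hv (y9 y hy v k), Or.inr (Or.inr (Or.inl k)), Or.inr (Or.inr (Or.inr k)),
        k.elim, k.elim, Or.inr (Or.inl k), Or.inl k, absurd hv.symm (z10 v k y hy)]
  · obtain ⟨ℓ, P, hPne, -, -, hPanti, hPZ, hPchain⟩ := hZ.resolve_left hne
    have hsub : ∀ i, P i ⊆ Z := fun i => hPZ ▸ Set.subset_iUnion P i
    obtain ⟨x, hx⟩ := Set.nonempty_iff_ne_empty.2 hne
    obtain ⟨i, -⟩ := Set.mem_iUnion.1 (hPZ ▸ hx)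
    obtain ⟨z, hz, hmin⟩ := (hPchain i).exists_min (hPne i)
    have hzZ := hsub i hz
    refine ⟨z, hzZ, isSimplicial_of_closedNbhd_subset (T := W ∪ (F2 ∪ F3)) ?_ hmin ?_⟩
    · refine kW.union_of_complete (kF2.union_of_complete kF3 ?_) ?_
      · intro a ha b hb
        rcases hempty with ⟨rfl, -⟩ | ⟨rfl, -⟩ | ⟨rfl, -⟩
        exacts [ha.elim, ha.elim, hb.elim]
      · rintro a ha b (hb | hb)
        exacts [w10 a ha b hb, w11 a ha b hb]
    · intro v hv
      have hvP : v ∈ Z → v ∈ P i := by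
        intro hvZ
        obtain ⟨j, hj⟩ := Set.mem_iUnion.1 (hPZ ▸ hvZ)
        by_cases hij : i = j
        · exact hij ▸ hj
        · exact absurd hv (hPanti i j hij z hz v hj)
      rcases hpart v with k | k | k | k | k | k | k | k | k | k | k | k | k | k
      exacts [absurd hv (z1 z hzZ v k), absurd hv (z2 z hzZ v k), absurd hv (z3 z hzZ v k),
        absurd hv (z4 z hzZ v k), absurd hv (z5 z hzZ v k), absurd hv (z6 z hzZ v k),
        absurd hv (z7 z hzZ v k), absurd hv (z8 z hzZ v k), absurd hv (z9 z hzZ v k),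
        Or.inr (Or.inr (Or.inl k)), Or.inr (Or.inr (Or.inr k)), Or.inr (Or.inl k),
        absurd hv (z10 z hzZ v k), Or.inl (hvP k)]
  · rw [Set.mem_union, not_or] at hu
    rcases hpart u with k | k | k | k | k | k | k | k | k | k | k | k | k | k
    exacts [w1 w hw u k, w2 w hw u k, w3 w hw u k, w4 w hw u k, w5 w hw u k, w6 w hw u k,
      w7 w hw u k, w8 w hw u k, w9 w hw u k, w10 w hw u k, w11 w hw u k, kW hw k huw.symm,
      absurd k hu.1, absurd k hu.2]
  · rcases F2.eq_empty_or_nonempty with h2 | h2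
    · rcases F3.eq_empty_or_nonempty with h3 | h3
      · exact Or.inl (h'.isThickening_T0 h2 h3)
      · exact Or.inr (h'.isThickening_T1 h2 h3)
    · have h3 : F3 = ∅ := by
        have := h2.ne_empty
        tauto
      exact Or.inr (h'.swap.isThickening_T1 h3 h2)

end Paper2P3
end

section
/- A graph G is (2P_3,C_4,C_6)-free, contains an induced C_7 or an induced T_0, and contains no simplicial vertices, if and only if G can be obtained from a thickening of a graph in ℳ ∪ {T_0,T_1} by possibly adding universal vertices to it. -/
open SimpleGraph

namespace Paper2P3

variable {V : Type*}

/-! ### Searching for forbidden patterns -/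

/-- The closed adjacency relation: equal or adjacent. -/
def CAdj {V : Type*} (G : SimpleGraph V) (u v : V) : Prop := u = v ∨ G.Adj u v

/-- The bits of the first list record which members of the second list are related to `v`. -/
def RowMatches {α : Type*} (Q : α → α → Prop) (v : α) : List Bool → List α → Prop
  | [], [] => True
  | b :: bs, x :: xs => (b = true ↔ Q v x) ∧ RowMatches Q v bs xs
  | _, _ => False

/-- The list `l` of elements can be extended so that the relation `Q` between the new elements
and the earlier ones is as prescribed by `rows`. -/
def Extends {α : Type*} (Q : α → α → Prop) : List (List Bool) → List α → Prop
  | [], _ => True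
  | row :: rows, l => ∃ v, RowMatches Q v row l ∧ Extends Q rows (v :: l)

/-- The closed adjacency pattern of `C_4`. -/
def rowsC4 : List (List Bool) := [[], [true], [true, false], [true, false, true]]

/-- The closed adjacency pattern of `C_6`. -/
def rowsC6 : List (List Bool) :=
  [[], [true], [true, false], [true, false, false], [true, false, false, false],
    [true, false, false, false, true]]

/-- The closed adjacency pattern of `2P_3`. -/
def rowsP3 : List (List Bool) :=
  [[], [true], [true, false], [false, false, false], [true, false, false, false],
    [true, false, false, false, false]]

/-- The relation `Q` contains one of the patterns `C_4`, `2P_3`, `C_6`. -/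
def Forbidden {α : Type*} (Q : α → α → Prop) : Prop :=
  Extends Q rowsC4 [] ∨ Extends Q rowsP3 [] ∨ Extends Q rowsC6 []

/-- Some `k < n` satisfies `p`. -/
def anyBelow : ℕ → (ℕ → Bool) → Bool
  | 0, _ => false
  | k + 1, p => p k || anyBelow k p

/-- All `k < n` satisfy `p`. -/
def allBelow : ℕ → (ℕ → Bool) → Bool
  | 0, _ => true
  | k + 1, p => p k && allBelow k p

lemma anyBelow_iff (n : ℕ) (p : ℕ → Bool) : anyBelow n p = true ↔ ∃ k < n, p k = true := by
  induction n with
  | zero => simp [anyBelow]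
  | succ n ih =>
    simp only [anyBelow, Bool.or_eq_true, ih]
    constructor
    · rintro (h | ⟨k, hk, h⟩)
      · exact ⟨n, by omega, h⟩
      · exact ⟨k, by omega, h⟩
    · rintro ⟨k, hk, h⟩
      rcases Nat.lt_succ_iff_lt_or_eq.1 hk with hk | rfl
      · exact Or.inr ⟨k, hk, h⟩
      · exact Or.inl h

lemma allBelow_iff (n : ℕ) (p : ℕ → Bool) : allBelow n p = true ↔ ∀ k < n, p k = true := by
  induction n with
  | zero => simp [allBelow]
  | succ n ih =>
    simp only [allBelow, Bool.and_eq_true, ih]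
    constructor
    · rintro ⟨h, h'⟩ k hk
      rcases Nat.lt_succ_iff_lt_or_eq.1 hk with hk | rfl
      · exact h' k hk
      · exact h
    · intro h
      exact ⟨h n (by omega), fun k hk => h k (by omega)⟩

/-- Boolean version of `RowMatches`. -/
def rowMatches (B : ℕ → ℕ → Bool) (v : ℕ) : List Bool → List ℕ → Bool
  | [], [] => true
  | b :: bs, x :: xs => (if b then B v x else !B v x) && rowMatches B v bs xs
  | _, _ => false

/-- Boolean version of `Extends`, with elements taken below `m`. -/
def extendsB (B : ℕ → ℕ → Bool) (m : ℕ) : List (List Bool) → List ℕ → Bool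
  | [], _ => true
  | row :: rows, l => anyBelow m fun v => rowMatches B v row l && extendsB B m rows (v :: l)

/-- Boolean version of `Forbidden`. -/
def forbiddenB (m : ℕ) (B : ℕ → ℕ → Bool) : Bool :=
  extendsB B m rowsC4 [] || (extendsB B m rowsP3 [] || extendsB B m rowsC6 [])

section Transfer

variable {α : Type*} {Q : α → α → Prop} {B : ℕ → ℕ → Bool} {m : ℕ}

lemma rowMatches_iff {v : ℕ} {a : α} {w : ℕ → α} {row : List Bool} {l : List ℕ}
    (h : ∀ x ∈ l, (B v x = true ↔ Q a (w x))) :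
    rowMatches B v row l = true ↔ RowMatches Q a row (l.map w) := by
  induction row generalizing l with
  | nil => cases l <;> simp [rowMatches, RowMatches]
  | cons b bs ih =>
    cases l with
    | nil => simp [rowMatches, RowMatches]
    | cons x xs =>
      have h1 := h x (by simp)
      have h2 := ih (l := xs) (fun y hy => h y (by simp [hy]))
      simp only [rowMatches, RowMatches, Bool.and_eq_true, List.map_cons, h2, ← h1]
      cases b <;> simp

lemma Extends.of_extendsB {w : ℕ → α} (hw : ∀ i < m, ∀ j < m, (B i j = true ↔ Q (w i) (w j)))
    {rows : List (List Bool)} {l : List ℕ} (hl : ∀ x ∈ l, x < m)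
    (h : extendsB B m rows l = true) : Extends Q rows (l.map w) := by
  induction rows generalizing l with
  | nil => trivial
  | cons row rows ih =>
    simp only [extendsB, anyBelow_iff, Bool.and_eq_true] at h
    obtain ⟨v, hv, h1, h2⟩ := h
    refine ⟨w v, (rowMatches_iff fun x hx => hw v hv x (hl x hx)).1 h1, ?_⟩
    refine ih (l := v :: l) ?_ h2
    simpa [hv] using hl

lemma RowMatches.map_rowMatches {π : α → ℕ} (hπ : ∀ u v, Q u v ↔ B (π u) (π v) = true)
    {v : α} {row : List Bool} {l : List α} (h : RowMatches Q v row l) :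
    rowMatches B (π v) row (l.map π) = true := by
  induction row generalizing l with
  | nil => cases l <;> simp_all [rowMatches, RowMatches]
  | cons b bs ih =>
    cases l with
    | nil => simp [RowMatches] at h
    | cons x xs =>
      simp only [RowMatches] at h
      simp only [rowMatches, List.map_cons, Bool.and_eq_true, ih h.2, and_true]
      have h1 := h.1
      rw [hπ] at h1
      cases b <;> simp_all

lemma Extends.extendsB {π : α → ℕ} (hπ : ∀ u v, Q u v ↔ B (π u) (π v) = true)
    (hm : ∀ u, π u < m) {rows : List (List Bool)} {l : List α} (h : Extends Q rows l) :
    extendsB B m rows (l.map π) = true := by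
  induction rows generalizing l with
  | nil => rfl
  | cons row rows ih =>
    obtain ⟨v, h1, h2⟩ := h
    simp only [Paper2P3.extendsB, anyBelow_iff, Bool.and_eq_true]
    exact ⟨π v, hm v, h1.map_rowMatches hπ, ih h2⟩

lemma Forbidden.forbiddenB {π : α → ℕ} (hπ : ∀ u v, Q u v ↔ B (π u) (π v) = true)
    (hm : ∀ u, π u < m) (h : Forbidden Q) : forbiddenB m B = true := by
  simp only [Paper2P3.forbiddenB, Bool.or_eq_true]
  exact h.imp (Extends.extendsB hπ hm) (Or.imp (Extends.extendsB hπ hm) (Extends.extendsB hπ hm))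

end Transfer

/-! ### Forbidden patterns and induced subgraphs -/

section Induced

variable {V : Type*} {G : SimpleGraph V}

lemma CAdj.symm {u v : V} (h : CAdj G u v) : CAdj G v u :=
  h.imp Eq.symm fun h' => h'.symm

instance [DecidableEq V] [DecidableRel G.Adj] : DecidableRel (CAdj G) :=
  fun _ _ => inferInstanceAs (Decidable (_ ∨ _))

instance : DecidableRel twoP3.Adj :=
  fun a b => decidable_of_iff _ (fromRel_adj _ a b).symm

lemma cadj_comm {u v : V} : CAdj G u v ↔ CAdj G v u := ⟨CAdj.symm, CAdj.symm⟩

lemma cadj_refl (u : V) : CAdj G u u := Or.inl rfl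

lemma CAdj.adj {u v : V} (h : CAdj G u v) (hne : u ≠ v) : G.Adj u v := h.resolve_left hne

/-- For a graph `H` without twins, induced copies can be recognized by closed adjacency. -/
lemma containsInduced_iff {W : Type*} {H : SimpleGraph W}
    (hH : ∀ i j, (∀ k, CAdj H i k ↔ CAdj H j k) → i = j) :
    ContainsInduced G H ↔ ∃ w : W → V, ∀ i j, CAdj G (w i) (w j) ↔ CAdj H i j := by
  constructor
  · rintro ⟨s, ⟨e⟩⟩
    refine ⟨fun i => (e i : V), fun i j => ?_⟩
    refine or_congr ?_ ?_
    · rw [Subtype.coe_inj, e.injective.eq_iff]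
    · exact e.map_rel_iff
  · rintro ⟨w, hw⟩
    have hinj : Function.Injective w := fun i j hij =>
      hH i j fun k => by rw [← hw, ← hw, hij]
    refine ⟨Set.range w, ⟨⟨Equiv.ofInjective w hinj, ?_⟩⟩⟩
    intro i j
    have h := hw i j
    simp only [CAdj, hinj.eq_iff] at h
    simp only [comap_adj, Function.Embedding.subtype_apply, Equiv.ofInjective_apply]
    constructor
    · intro hadj
      exact (h.1 (Or.inr hadj)).resolve_left fun e => G.ne_of_adj hadj (congrArg w e)
    · intro hadj
      exact (h.2 (Or.inr hadj)).resolve_left (H.ne_of_adj hadj)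

/-- A closed adjacency relation is determined by its values below the diagonal. -/
lemma cadj_iff_of_lt {n : ℕ} {H : SimpleGraph (Fin n)} {w : Fin n → V}
    (h : ∀ i j, j < i → (CAdj G (w i) (w j) ↔ CAdj H i j)) (i j : Fin n) :
    CAdj G (w i) (w j) ↔ CAdj H i j := by
  rcases lt_trichotomy i j with hij | rfl | hij
  · rw [cadj_comm, h j i hij, cadj_comm]
  · simp [cadj_refl]
  · exact h i j hij

lemma containsInduced_cycle_four_iff :
    ContainsInduced G (cycleGraph 4) ↔ Extends (CAdj G) rowsC4 [] := by
  rw [containsInduced_iff (by decide)]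
  constructor
  · rintro ⟨w, hw⟩
    refine ⟨w 0, ?_, w 1, ?_, w 2, ?_, w 3, ?_, trivial⟩ <;>
      simp only [RowMatches, hw] <;> decide
  · rintro ⟨a, -, b, hb, c, hc, d, hd, -⟩
    refine ⟨![a, b, c, d], cadj_iff_of_lt fun i j hij => ?_⟩
    simp only [RowMatches, and_true] at hb hc hd
    fin_cases i <;> fin_cases j <;> first | exact absurd hij (by decide) | skip
    all_goals
      first
      | exact Iff.trans (Iff.symm hb) (of_decide_eq_true rfl)
      | exact Iff.trans (Iff.symm hc.1) (of_decide_eq_true rfl)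
      | exact Iff.trans (Iff.symm hc.2) (of_decide_eq_true rfl)
      | exact Iff.trans (Iff.symm hd.1) (of_decide_eq_true rfl)
      | exact Iff.trans (Iff.symm hd.2.1) (of_decide_eq_true rfl)
      | exact Iff.trans (Iff.symm hd.2.2) (of_decide_eq_true rfl)

lemma containsInduced_twoP3_iff :
    ContainsInduced G twoP3 ↔ Extends (CAdj G) rowsP3 [] := by
  rw [containsInduced_iff (by decide)]
  constructor
  · rintro ⟨w, hw⟩
    refine ⟨w 0, ?_, w 1, ?_, w 2, ?_, w 3, ?_, w 4, ?_, w 5, ?_, trivial⟩ <;>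
      simp only [RowMatches, hw] <;> decide
  · rintro ⟨a, -, b, hb, c, hc, d, hd, e, he, f, hf, -⟩
    refine ⟨![a, b, c, d, e, f], cadj_iff_of_lt fun i j hij => ?_⟩
    simp only [RowMatches, and_true] at hb hc hd he hf
    fin_cases i <;> fin_cases j <;> first | exact absurd hij (by decide) | skip
    all_goals
      first
      | exact Iff.trans (Iff.symm hb) (of_decide_eq_true rfl)
      | exact Iff.trans (Iff.symm hc.1) (of_decide_eq_true rfl)
      | exact Iff.trans (Iff.symm hc.2) (of_decide_eq_true rfl)
      | exact Iff.trans (Iff.symm hd.1) (of_decide_eq_true rfl)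
      | exact Iff.trans (Iff.symm hd.2.1) (of_decide_eq_true rfl)
      | exact Iff.trans (Iff.symm hd.2.2) (of_decide_eq_true rfl)
      | exact Iff.trans (Iff.symm he.1) (of_decide_eq_true rfl)
      | exact Iff.trans (Iff.symm he.2.1) (of_decide_eq_true rfl)
      | exact Iff.trans (Iff.symm he.2.2.1) (of_decide_eq_true rfl)
      | exact Iff.trans (Iff.symm he.2.2.2) (of_decide_eq_true rfl)
      | exact Iff.trans (Iff.symm hf.1) (of_decide_eq_true rfl)
      | exact Iff.trans (Iff.symm hf.2.1) (of_decide_eq_true rfl)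
      | exact Iff.trans (Iff.symm hf.2.2.1) (of_decide_eq_true rfl)
      | exact Iff.trans (Iff.symm hf.2.2.2.1) (of_decide_eq_true rfl)
      | exact Iff.trans (Iff.symm hf.2.2.2.2) (of_decide_eq_true rfl)

lemma containsInduced_cycle_six_iff :
    ContainsInduced G (cycleGraph 6) ↔ Extends (CAdj G) rowsC6 [] := by
  rw [containsInduced_iff (by decide)]
  constructor
  · rintro ⟨w, hw⟩
    refine ⟨w 0, ?_, w 1, ?_, w 2, ?_, w 3, ?_, w 4, ?_, w 5, ?_, trivial⟩ <;>
      simp only [RowMatches, hw] <;> decide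
  · rintro ⟨a, -, b, hb, c, hc, d, hd, e, he, f, hf, -⟩
    refine ⟨![a, b, c, d, e, f], cadj_iff_of_lt fun i j hij => ?_⟩
    simp only [RowMatches, and_true] at hb hc hd he hf
    fin_cases i <;> fin_cases j <;> first | exact absurd hij (by decide) | skip
    all_goals
      first
      | exact Iff.trans (Iff.symm hb) (of_decide_eq_true rfl)
      | exact Iff.trans (Iff.symm hc.1) (of_decide_eq_true rfl)
      | exact Iff.trans (Iff.symm hc.2) (of_decide_eq_true rfl)
      | exact Iff.trans (Iff.symm hd.1) (of_decide_eq_true rfl)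
      | exact Iff.trans (Iff.symm hd.2.1) (of_decide_eq_true rfl)
      | exact Iff.trans (Iff.symm hd.2.2) (of_decide_eq_true rfl)
      | exact Iff.trans (Iff.symm he.1) (of_decide_eq_true rfl)
      | exact Iff.trans (Iff.symm he.2.1) (of_decide_eq_true rfl)
      | exact Iff.trans (Iff.symm he.2.2.1) (of_decide_eq_true rfl)
      | exact Iff.trans (Iff.symm he.2.2.2) (of_decide_eq_true rfl)
      | exact Iff.trans (Iff.symm hf.1) (of_decide_eq_true rfl)
      | exact Iff.trans (Iff.symm hf.2.1) (of_decide_eq_true rfl)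
      | exact Iff.trans (Iff.symm hf.2.2.1) (of_decide_eq_true rfl)
      | exact Iff.trans (Iff.symm hf.2.2.2.1) (of_decide_eq_true rfl)
      | exact Iff.trans (Iff.symm hf.2.2.2.2) (of_decide_eq_true rfl)

lemma not_forbidden_iff : ¬ Forbidden (CAdj G) ↔
    HFree G twoP3 ∧ HFree G (cycleGraph 4) ∧ HFree G (cycleGraph 6) := by
  simp only [Forbidden, HFree, containsInduced_cycle_four_iff, containsInduced_cycle_six_iff,
    containsInduced_twoP3_iff]
  tauto

end Induced
/-! ### Traces on a fixed induced subgraph -/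

/-- The closed adjacency matrix of a graph on `n` vertices, given by `base`, extended by two
vertices with traces `s` and `t` (as bit masks), whose mutual closed adjacency is `b`. -/
def pairMatrix (n : ℕ) (base : ℕ → ℕ → Bool) (s t : ℕ) (b : Bool) (i j : ℕ) : Bool :=
  bif Nat.blt i n then
    bif Nat.blt j n then base i j else bif Nat.beq j n then s.testBit i else t.testBit i
  else bif Nat.beq i n then
    bif Nat.blt j n then s.testBit j else bif Nat.beq j n then true else b
  else
    bif Nat.blt j n then t.testBit j else bif Nat.beq j n then b else true

/-- The closed adjacency pattern of `2P_3`, starting with the middle vertex of a `P_3`. -/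
def rowsP3' : List (List Bool) :=
  [[], [true], [false, true], [false, false, false], [true, false, false, false],
    [true, false, false, false, false]]

/-- Two vertices with traces `s` and `t` cannot have mutual closed adjacency `b`, because
otherwise the second one would belong to a forbidden pattern. -/
def excluded (n : ℕ) (base : ℕ → ℕ → Bool) (s t : ℕ) (b : Bool) : Bool :=
  [rowsC4, rowsP3, rowsP3', rowsC6].any fun rows =>
    extendsB (pairMatrix n base s t b) (n + 2) rows.tail [n + 1]

/-- In a graph `G` without forbidden patterns, the vertices `f 0, …, f (n - 1)` induce the graph
with closed adjacency matrix `base`, and `t v` is the bit mask of the set of those `i`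
for which `f i` belongs to the closed neighborhood of `v`. -/
structure Frame {V : Type*} (G : SimpleGraph V) (n : ℕ) (base : ℕ → ℕ → Bool) (f : ℕ → V)
    (t : V → ℕ) : Prop where
  free : ¬ Forbidden (CAdj G)
  base_iff : ∀ i < n, ∀ j < n, (base i j = true ↔ CAdj G (f i) (f j))
  trace_iff : ∀ v, ∀ i < n, ((t v).testBit i = true ↔ CAdj G v (f i))
  trace_lt : ∀ v, t v < 2 ^ n

section Frame

variable {V : Type*} {G : SimpleGraph V} {n : ℕ} {base : ℕ → ℕ → Bool} {f : ℕ → V} {t : V → ℕ}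

/-- Every finite part of a predicate on `ℕ` is the set of bits of some number. -/
lemma exists_bits (n : ℕ) (p : ℕ → Prop) :
    ∃ m < 2 ^ n, ∀ i < n, (m.testBit i = true ↔ p i) := by
  classical
  refine ⟨Nat.ofBits fun i : Fin n => decide (p i), Nat.ofBits_lt_two_pow _, fun i hi => ?_⟩
  rw [Nat.testBit_ofBits_lt _ _ hi]
  simp

lemma exists_frame {H : SimpleGraph (Fin n)} (hG : ¬ Forbidden (CAdj G))
    (hH : ∀ i j : Fin n, base i j = true ↔ CAdj H i j) {w : Fin n → V}
    (hw : ∀ i j, CAdj G (w i) (w j) ↔ CAdj H i j) (v₀ : V) : ∃ f t, Frame G n base f t := by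
  choose t ht using fun v => exists_bits n fun i => ∃ h : i < n, CAdj G v (w ⟨i, h⟩)
  refine ⟨fun i => if h : i < n then w ⟨i, h⟩ else v₀, t, hG, ?_, ?_, fun v => (ht v).1⟩
  · intro i hi j hj
    simpa [hi, hj, hw] using hH ⟨i, hi⟩ ⟨j, hj⟩
  · intro v i hi
    simp [(ht v).2 i hi, hi]

lemma extends_rowsP3_of_rowsP3' {b : V} (h : Extends (CAdj G) rowsP3'.tail [b]) :
    Extends (CAdj G) rowsP3 [] := by
  obtain ⟨a, ha, c, hc, d, hd, e, he, g, hg, -⟩ := h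
  refine ⟨a, trivial, b, ?_, c, ?_, d, ?_, e, ?_, g, ?_, trivial⟩ <;>
    simp_all [RowMatches, cadj_comm]

lemma Frame.not_excluded (F : Frame G n base f t) {u v : V} {b : Bool}
    (hb : b = true ↔ CAdj G u v) : excluded n base (t u) (t v) b ≠ true := by
  intro h
  have e₁ : Nat.blt n n = false := by simp [Bool.eq_false_iff, Nat.blt_eq]
  have e₂ : Nat.blt (n + 1) n = false := by simp [Bool.eq_false_iff, Nat.blt_eq]
  have e₃ : Nat.beq (n + 1) n = false := by simp [Bool.eq_false_iff, Nat.beq_eq]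
  have e₄ : ∀ i < n, Nat.blt i n = true := fun i hi => by rwa [Nat.blt_eq]
  have hu := F.trace_iff u
  have hv := F.trace_iff v
  have key : ∀ i < n + 2, i < n ∨ i = n ∨ i = n + 1 := by omega
  have hw : ∀ i < n + 2, ∀ j < n + 2, (pairMatrix n base (t u) (t v) b i j = true ↔
      CAdj G (if i < n then f i else if i = n then u else v)
        (if j < n then f j else if j = n then u else v)) := by
    intro i hi j hj
    rcases key i hi with hi | rfl | rfl <;> rcases key j hj with hj | rfl | rfl <;>
      simp [pairMatrix, *, F.base_iff, cadj_refl]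
    all_goals exact cadj_comm
  simp only [excluded, List.any_cons, List.any_nil, Bool.or_false, Bool.or_eq_true] at h
  rcases h with h | h | h | h <;> have h' := Extends.of_extendsB hw (by simp) h
  · exact F.free (Or.inl ⟨_, trivial, h'⟩)
  · exact F.free (Or.inr (Or.inl ⟨_, trivial, h'⟩))
  · exact F.free (Or.inr (Or.inl (extends_rowsP3_of_rowsP3' h')))
  · exact F.free (Or.inr (Or.inr ⟨_, trivial, h'⟩))

lemma Frame.cadj_of_excluded (F : Frame G n base f t) {u v : V}
    (h : excluded n base (t u) (t v) false = true) : CAdj G u v := by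
  by_contra hc
  exact F.not_excluded (by simpa using hc) h

lemma Frame.not_cadj_of_excluded (F : Frame G n base f t) {u v : V}
    (h : excluded n base (t u) (t v) true = true) : ¬ CAdj G u v :=
  fun hc => F.not_excluded (by simpa using hc) h

lemma Frame.not_excluded_self (F : Frame G n base f t) (v : V) :
    excluded n base (t v) (t v) true ≠ true :=
  F.not_excluded (by simp [cadj_refl])

lemma Frame.trace_base (F : Frame G n base f t) {i m : ℕ} (hi : i < n) (hm : m < 2 ^ n)
    (h : ∀ j < n, m.testBit j = base i j) : t (f i) = m := by
  refine Nat.eq_of_testBit_eq fun j => ?_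
  by_cases hj : j < n
  · rw [h j hj, Bool.eq_iff_iff, F.trace_iff _ _ hj, F.base_iff i hi j hj]
  · have hle : 2 ^ n ≤ 2 ^ j := Nat.pow_le_pow_right (by norm_num) (by omega)
    rw [Nat.testBit_lt_two_pow ((F.trace_lt _).trans_le hle),
      Nat.testBit_lt_two_pow (hm.trans_le hle)]

end Frame

/-! ### Finding simplicial vertices -/

section Simplicial

variable {V : Type*} {G : SimpleGraph V}

lemma no_C4 (hG : ¬ Forbidden (CAdj G)) {a b c d : V} (hab : CAdj G a b) (hbc : CAdj G b c)
    (hcd : CAdj G c d) (hda : CAdj G d a) (hac : ¬ CAdj G a c) (hbd : ¬ CAdj G b d) : False := by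
  refine hG (Or.inl ⟨a, trivial, b, ?_, c, ?_, d, ?_, trivial⟩) <;>
    simp_all [RowMatches, cadj_comm]

/-- A set of vertices whose components are cliques and whose outside neighborhoods behave well
contains a simplicial vertex. -/
lemma exists_isSimplicial [Finite V] {A : Set V} (hA : A.Nonempty)
    (h₁ : ∀ a ∈ A, ∀ b ∈ A, ∀ c ∈ A, CAdj G a b → CAdj G b c → CAdj G a c)
    (h₂ : ∀ a ∈ A, ∀ u ∉ A, ∀ v ∉ A, CAdj G a u → CAdj G a v → CAdj G u v)
    (h₃ : ∀ a ∈ A, ∀ b ∈ A, ∀ u ∉ A, ∀ v ∉ A, CAdj G a b → CAdj G a u → CAdj G b v →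
      ¬ CAdj G b u → ¬ CAdj G a v → False) : ∃ v, IsSimplicial G v := by
  obtain ⟨a, ha, hmin⟩ := A.toFinite.exists_minimalFor (fun v => {w | CAdj G v w}.ncard) A hA
  have mixed : ∀ u ∈ A, ∀ v ∉ A, CAdj G a u → CAdj G a v → CAdj G u v := by
    intro u hu v hv hau hav
    by_contra huv
    obtain ⟨w, huw, haw⟩ : ∃ w, CAdj G u w ∧ ¬ CAdj G a w := by
      by_contra! hsub
      have hlt : {w | CAdj G u w}.ncard < {w | CAdj G a w}.ncard :=
        Set.ncard_lt_ncard ⟨hsub, fun h => huv (h hav)⟩ (Set.toFinite _)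
      exact absurd (hmin hu hlt.le) (by simpa using hlt)
    have hw : w ∉ A := fun hw => haw (h₁ a ha u hu w hw hau huw)
    exact h₃ a ha u hu v hv w hw hau hav huw huv haw
  refine ⟨a, fun u hu v hv hne => ?_⟩
  have hu : CAdj G a u := Or.inr hu
  have hv : CAdj G a v := Or.inr hv
  refine CAdj.adj ?_ hne
  by_cases huA : u ∈ A <;> by_cases hvA : v ∈ A
  · exact h₁ u huA a ha v hvA hu.symm hv
  · exact mixed u huA v hvA hu hv
  · exact (mixed v hvA u huA hv hu).symm
  · exact h₂ a ha u huA v hvA hu hv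

variable {n : ℕ} {base : ℕ → ℕ → Bool} {f : ℕ → V} {t : V → ℕ}

/-- Vertices with traces `s` and `s'` that have adjacent neighbors of trace `m`, or a common
neighbor of trace `m`, are adjacent to each other or create a forbidden pattern. -/
def closesUp (n : ℕ) (base : ℕ → ℕ → Bool) (m s s' : ℕ) : Bool :=
  ((anyBelow n fun i => !m.testBit i && (s.testBit i && s'.testBit i)) &&
    anyBelow n fun i => s.testBit i && (!s'.testBit i && (!m.testBit i &&
      anyBelow n fun j => s'.testBit j && (!s.testBit j && (!m.testBit j && base i j))))) ||
  (excluded n base s s' false || excluded n base m s' true)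

lemma Frame.exists_isSimplicial [Finite V] (F : Frame G n base f t) {m : ℕ} {L : List ℕ}
    (hm : ∃ v, t v = m) (hL : ∀ v, t v = m ∨ t v ∈ L)
    (h₁ : ∀ a b c, t a = m → t b = m → t c = m → CAdj G a b → CAdj G b c → CAdj G a c)
    (hc : (L.all fun s => excluded n base m s true ||
      L.all fun s' => closesUp n base m s s') = true) :
    ∃ v, IsSimplicial G v := by
  have key : ∀ u v a b, t a = m → t b = m → t u ≠ m → t v ≠ m → CAdj G a u → CAdj G b v →
      CAdj G u v ∨ (∃ i < n, ¬ CAdj G a (f i) ∧ CAdj G u (f i) ∧ CAdj G v (f i)) ∧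
        ∃ i < n, ∃ j < n, CAdj G (f i) (f j) ∧ CAdj G u (f i) ∧ ¬ CAdj G v (f i) ∧
          CAdj G v (f j) ∧ ¬ CAdj G u (f j) ∧ ¬ CAdj G a (f i) ∧ ¬ CAdj G b (f i) ∧
          ¬ CAdj G a (f j) ∧ ¬ CAdj G b (f j) := by
    intro u v a b ha hb hu hv hau hbv
    simp only [List.all_eq_true, Bool.or_eq_true] at hc
    rcases hc _ ((hL u).resolve_left hu) with h | h
    · rw [← ha] at h
      exact absurd hau (F.not_cadj_of_excluded h)
    replace h := h _ ((hL v).resolve_left hv)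
    simp only [closesUp, Bool.or_eq_true, Bool.and_eq_true, anyBelow_iff, Bool.not_eq_true'] at h
    rcases h with ⟨⟨i, hi, h₁, h₂, h₃⟩, j, hj, h₄, h₅, h₆, k, hk, h₇, h₈, h₉, h₁₀⟩ | h | h
    rotate_left
    · exact Or.inl (F.cadj_of_excluded h)
    · rw [← hb] at h
      exact absurd hbv (F.not_cadj_of_excluded h)
    · have ha' := fun i hi => F.trace_iff a i hi
      have hb' := fun i hi => F.trace_iff b i hi
      rw [ha] at ha'
      rw [hb] at hb'
      right
      refine ⟨⟨i, hi, ?_, ?_, ?_⟩, j, hj, k, hk,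
        (F.base_iff j hj k hk).1 h₁₀, ?_, ?_, ?_, ?_, ?_, ?_, ?_, ?_⟩ <;>
        simp only [← ha', ← hb', ← F.trace_iff, Bool.not_eq_true, *]
  refine Paper2P3.exists_isSimplicial (A := {v | t v = m}) hm
    (fun a ha b hb c hc => h₁ a b c ha hb hc) ?_ ?_
  · intro a ha u hu v hv hau hav
    by_contra huv
    rcases key u v a a ha ha hu hv hau hav with h | ⟨⟨i, hi, h₁, h₂, h₃⟩, -⟩
    · exact huv h
    · exact no_C4 F.free hau h₂ h₃.symm hav.symm h₁ huv
  · intro a ha b hb u hu v hv hab hau hbv hbu hav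
    rcases key u v a b ha hb hu hv hau hbv with
      h | ⟨-, i, hi, j, hj, h₁, h₂, h₃, h₄, h₅, h₆, h₇, h₈, h₉⟩
    · exact no_C4 F.free hab hbv h.symm hau.symm hav hbu
    · refine F.free (Or.inr (Or.inr ⟨u, trivial, f i, ?_, f j, ?_, v, ?_, b, ?_, a, ?_, trivial⟩))
      all_goals
        have huv : ¬ CAdj G u v := fun huv => no_C4 F.free hab hbv huv.symm hau.symm hav hbu
        simp_all [RowMatches, cadj_comm]

end Simplicial

section Traces

variable {V : Type*} {G : SimpleGraph V} {n : ℕ} {base : ℕ → ℕ → Bool} {f : ℕ → V} {t : V → ℕ}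

/-- If the fixed induced subgraph contains an induced `P_3`, then the vertices with
empty trace induce a disjoint union of cliques. -/
lemma Frame.cadj_trans_of_trace_zero (F : Frame G n base f t) {i j k : ℕ} (hi : i < n)
    (hj : j < n) (hk : k < n) (hij : base i j = true) (hjk : base j k = true)
    (hik : base i k = false) {a b c : V} (ha : t a = 0) (hb : t b = 0) (hc : t c = 0)
    (hab : CAdj G a b) (hbc : CAdj G b c) : CAdj G a c := by
  by_contra hac
  have key : ∀ v, t v = 0 → ∀ i < n, ¬ CAdj G (f i) v := by
    intro v hv i hi h
    have := (F.trace_iff v i hi).2 h.symm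
    simp [hv] at this
  rw [F.base_iff i hi j hj] at hij
  rw [F.base_iff j hj k hk] at hjk
  rw [← Bool.not_eq_true, F.base_iff i hi k hk] at hik
  refine F.free (Or.inr (Or.inl
    ⟨a, trivial, b, ?_, c, ?_, f i, ?_, f j, ?_, f k, ?_, trivial⟩)) <;>
    simp [RowMatches, key _ ha, key _ hb, key _ hc, hi, hj, hk, hab.symm, hbc.symm, hij.symm,
      hjk.symm, cadj_comm (u := c) (v := a), cadj_comm (u := f k) (v := f i), hac, hik]

end Traces

/-! ### Building thickenings -/

section Thickening

lemma IsThickening.of_forall_mem {α β : Type*} {Gs : SimpleGraph β} {M : SimpleGraph α}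
    {D : Set α} (hD : ∀ j, j ∈ D) (h : IsThickening Gs (M.induce D)) : IsThickening Gs M := by
  obtain ⟨X, h₁, h₂, h₃, h₄, h₅⟩ := h
  refine ⟨fun j => X ⟨j, hD j⟩, fun v => h₁ _, fun u v huv => h₂ _ _ (by simpa using huv), ?_,
    fun v => h₄ _, fun u v huv => by simpa using h₅ ⟨u, hD u⟩ ⟨v, hD v⟩ (by simpa using huv)⟩
  rw [Set.eq_univ_iff_forall] at h₃ ⊢
  intro x
  obtain ⟨j, hj⟩ := Set.mem_iUnion.1 (h₃ x)
  exact Set.mem_iUnion.2 ⟨j, hj⟩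

variable {V : Type*} {G : SimpleGraph V}

/-- A labelling of the vertices by the vertices of `M`, or by `full` for universal vertices,
exhibits a thickening. -/
lemma exists_isThickening {α : Type*} {M : SimpleGraph α} {t : V → ℕ} {lab : α → ℕ} {full : ℕ}
    (hlab : ∀ v, t v = full ∨ ∃ j, t v = lab j) (hne : ∀ j, lab j ≠ full)
    (hinj : Function.Injective lab)
    (hadj : ∀ u v i j, t u = lab i → t v = lab j → (CAdj G u v ↔ CAdj M i j))
    (hfull : ∀ u v, t u = full → CAdj G u v) :
    ∃ S : Set V, IsThickening (G.induce S) (M.induce {j | ∃ v, t v = lab j}) ∧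
      G.IsClique Sᶜ ∧ Complete G Sᶜ S := by
  refine ⟨{v | t v ≠ full}, ⟨fun j => {v | t v = lab j}, ?_, ?_, ?_, ?_, ?_⟩, ?_, ?_⟩
  · rintro ⟨j, v, hv⟩
    exact ⟨⟨v, by simpa [hv] using hne j⟩, hv⟩
  · rintro ⟨i, hi⟩ ⟨j, hj⟩ hij
    rw [Set.disjoint_left]
    intro v hv hv'
    simp only [Set.mem_ofPred_eq] at hv hv'
    exact hij (Subtype.ext (hinj (hv.symm.trans hv')))
  · rw [Set.eq_univ_iff_forall]
    rintro ⟨v, hv⟩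
    obtain ⟨j, hj⟩ := (hlab v).resolve_left hv
    exact Set.mem_iUnion.2 ⟨⟨j, v, hj⟩, hj⟩
  · rintro ⟨i, hi⟩ u hu v hv huv
    exact ((hadj u v i i hu hv).2 (cadj_refl i)).adj (by simpa [Subtype.ext_iff] using huv)
  · rintro ⟨i, hi⟩ ⟨j, hj⟩ hij
    have hij' : i ≠ j := by simpa using hij
    constructor
    · intro h u hu v hv
      refine ((hadj u v i j hu hv).2 (Or.inr h)).adj fun huv => hij' (hinj ?_)
      rw [← hu, ← hv, huv]
    · intro h u hu v hv huv
      exact h (((hadj u v i j hu hv).1 (Or.inr huv)).adj hij')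
  · intro u hu v hv huv
    exact (hfull u v (by simpa using hu)).adj huv
  · intro u hu v hv
    refine (hfull u v (by simpa using hu)).adj ?_
    rintro rfl
    exact hu hv

lemma Frame.exists_isThickening {n k full : ℕ} {base : ℕ → ℕ → Bool} {f : ℕ → V} {t : V → ℕ}
    (F : Frame G n base f t) {M : SimpleGraph (Fin k)} [DecidableRel M.Adj] {lab : Fin k → ℕ}
    (hlab : ∀ v, t v = full ∨ ∃ j, t v = lab j) (hne : ∀ j, lab j ≠ full)
    (hinj : Function.Injective lab)
    (hadj : ∀ i j, excluded n base (lab i) (lab j) (!decide (CAdj M i j)) = true)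
    (hfull : ∀ v, excluded n base full (t v) false = true) :
    ∃ S : Set V, IsThickening (G.induce S) (M.induce {j | ∃ v, t v = lab j}) ∧
      G.IsClique Sᶜ ∧ Complete G Sᶜ S := by
  refine Paper2P3.exists_isThickening hlab hne hinj ?_ ?_
  · intro u v i j hu hv
    have h := hadj i j
    rw [← hu, ← hv] at h
    by_cases hM : CAdj M i j
    · simp only [hM, decide_true, Bool.not_true] at h
      exact iff_of_true (F.cadj_of_excluded h) hM
    · simp only [hM, decide_false, Bool.not_false] at h
      exact iff_of_false (F.not_cadj_of_excluded h) hM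
  · intro u v hu
    have h := hfull v
    rw [← hu] at h
    exact F.cadj_of_excluded h

/-- Properties of graphs obtained from thickenings by adding universal vertices, reduced to a
computation with the closed adjacency matrix `B`; the index `k` stands for universal vertices. -/
lemma properties_of_isThickening {α : Type*} {M : SimpleGraph α} {e : α → ℕ} {k n : ℕ}
    {B : ℕ → ℕ → Bool} {H : SimpleGraph (Fin n)} (he : ∀ a, e a < k)
    (hB : ∀ a b, B (e a) (e b) = true ↔ CAdj M a b)
    (hfull : allBelow (k + 1) (fun i => B i k && B k i) = true)
    (hrep : ∀ i : Fin n, ∃ a, e a = i) (hforb : forbiddenB (k + 1) B = false)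
    (hH : ∀ i j : Fin n, B i j = true ↔ CAdj H i j)
    (hH' : ∀ i j, (∀ k, CAdj H i k ↔ CAdj H j k) → i = j)
    (hsimp : allBelow (k + 1) (fun i => anyBelow n fun j => anyBelow n fun l =>
      B i j && (B i l && !B j l)) = true)
    {S : Set V} (hS : IsThickening (G.induce S) M) (hcl : G.IsClique Sᶜ)
    (hco : Complete G Sᶜ S) :
    ¬ Forbidden (CAdj G) ∧ ContainsInduced G H ∧ ∀ v, ¬ IsSimplicial G v := by
  classical
  obtain ⟨X, h₁, h₂, h₃, h₄, h₅⟩ := hS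
  rw [Set.eq_univ_iff_forall] at h₃
  simp only [Set.mem_iUnion] at h₃
  choose c hc using h₃
  have hcX : ∀ {v : S} {a}, v ∈ X a → c v = a := by
    intro v a hv
    by_contra hne
    exact Set.disjoint_left.1 (h₂ _ _ hne) (hc v) hv
  set π : V → ℕ := fun v => if h : v ∈ S then e (c ⟨v, h⟩) else k with hπ
  have hπlt : ∀ v, π v < k + 1 := by
    intro v
    simp only [hπ]
    split
    · exact (he _).trans (Nat.lt_succ_self k)
    · exact Nat.lt_succ_self k
  simp only [allBelow_iff, Bool.and_eq_true] at hfull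
  have hπadj : ∀ u v, CAdj G u v ↔ B (π u) (π v) = true := by
    intro u v
    by_cases hu : u ∈ S <;> by_cases hv : v ∈ S
    · simp only [hπ, hu, hv, dif_pos, hB]
      by_cases hcc : c ⟨u, hu⟩ = c ⟨v, hv⟩
      · rw [hcc]
        refine iff_of_true ?_ (cadj_refl _)
        by_cases huv : u = v
        · exact Or.inl huv
        · have h := hc ⟨v, hv⟩
          rw [← hcc] at h
          exact Or.inr (h₄ _ (hc ⟨u, hu⟩) h (by simpa using huv))
      · have huv : u ≠ v := by
          rintro rfl
          exact hcc rfl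
        constructor
        · intro h
          by_contra hM
          exact (h₅ _ _ hcc).2 (fun h' => hM (Or.inr h')) _ (hc _) _ (hc _) (h.adj huv)
        · intro h
          exact Or.inr ((h₅ _ _ hcc).1 (h.adj hcc) _ (hc _) _ (hc _))
    · have : π v = k := by simp [hπ, hv]
      rw [this]
      exact iff_of_true (Or.inr (hco v hv u hu).symm) (hfull _ (hπlt u)).1
    · have : π u = k := by simp [hπ, hu]
      rw [this]
      exact iff_of_true (Or.inr (hco u hu v hv)) (hfull _ (hπlt v)).2
    · have : π v = k := by simp [hπ, hv]
      rw [this]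
      refine iff_of_true ?_ (hfull _ (hπlt u)).1
      by_cases huv : u = v
      · exact Or.inl huv
      · exact Or.inr (hcl hu hv huv)
  have hw : ∀ i : Fin n, ∃ v, π v = i := by
    intro i
    obtain ⟨a, ha⟩ := hrep i
    obtain ⟨v, hv⟩ := h₁ a
    exact ⟨v, by simp [hπ, hcX hv, ha]⟩
  choose w hw using hw
  refine ⟨fun h => ?_, ?_, ?_⟩
  · simpa [hforb] using h.forbiddenB hπadj hπlt
  · rw [containsInduced_iff hH']
    exact ⟨w, fun i j => by rw [hπadj, hw, hw, hH]⟩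
  · intro v hv
    simp only [allBelow_iff, anyBelow_iff, Bool.and_eq_true, Bool.not_eq_true'] at hsimp
    obtain ⟨i, hi, j, hj, hvi, hvj, hij⟩ := hsimp _ (hπlt v)
    have hi' := hw ⟨i, hi⟩
    have hj' := hw ⟨j, hj⟩
    simp only at hi' hj'
    rw [← hi', ← hπadj] at hvi
    rw [← hj', ← hπadj] at hvj
    rw [← hi', ← hj', ← Bool.not_eq_true, ← hπadj] at hij
    refine hij ?_
    by_cases h₁ : v = w ⟨i, hi⟩
    · rwa [← h₁]
    by_cases h₂ : v = w ⟨j, hj⟩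
    · rw [← h₂]
      exact hvi.symm
    by_cases h₃ : w ⟨i, hi⟩ = w ⟨j, hj⟩
    · exact Or.inl h₃
    · exact Or.inr (hv (hvi.adj h₁) (hvj.adj h₂) h₃)

end Thickening

/-! ### Computations for `C_7` -/

/-- The closed adjacency matrix of `C_7`. -/
def baseC7 (i j : ℕ) : Bool := Nat.testBit 430473893610435 (7 * i + j)

/-- The nonempty proper traces on `C_7`: for `i < 7`, the numbers `i`, `i + 7`, `i + 14` stand for
the traces of the classes `X_i`, `Y_i`, `Z_i`. -/
def maskC7 (k : ℕ) : ℕ :=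
  [67, 7, 14, 28, 56, 112, 97, 19, 38, 76, 25, 50, 100, 73,
    31, 62, 124, 121, 115, 103, 79].getD k 0

/-- The adjacency between the classes of traces on `C_7`. -/
def classAdj (k l : ℕ) : Bool :=
  Nat.testBit (([67, 73, 121, 19, 127, 123, 31, 95, 127] : List ℕ).getD (3 * (k / 7) + l / 7) 0)
    ((l % 7 + (7 - k % 7)) % 7)

/-- The pairs of classes of traces on `C_7` that exclude each other. -/
def classIncompatible (k l : ℕ) : Bool :=
  Nat.testBit (([0, 0, 0, 0, 102, 96, 0, 6, 36] : List ℕ).getD (3 * (k / 7) + l / 7) 0)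
    ((l % 7 + (7 - k % 7)) % 7)

/-- Rotation of the classes of traces on `C_7`. -/
def rotClass (a k : ℕ) : ℕ := k / 7 * 7 + (k % 7 + a) % 7

set_option maxRecDepth 10000

lemma trace_C7 : allBelow 128 (fun m => Nat.beq m 0 || (Nat.beq m 127 ||
    (anyBelow 21 (fun k => Nat.beq m (maskC7 k)) || excluded 7 baseC7 m m true))) = true := by
  decide +kernel

lemma classAdj_C7 : allBelow 21 (fun k => allBelow 21 fun l =>
    excluded 7 baseC7 (maskC7 k) (maskC7 l) (!classAdj k l)) = true := by
  decide +kernel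

lemma classIncompatible_C7 : allBelow 21 (fun k => allBelow 21 fun l =>
    !classIncompatible k l ||
      excluded 7 baseC7 (maskC7 k) (maskC7 l) (classAdj k l)) = true := by
  decide +kernel

lemma full_C7 : ((127 :: (List.range 21).map maskC7).all fun s =>
    excluded 7 baseC7 127 s false) = true := by
  decide +kernel

lemma closesUp_C7 : ((127 :: (List.range 21).map maskC7).all fun s =>
    excluded 7 baseC7 0 s true ||
      (127 :: (List.range 21).map maskC7).all fun s' => closesUp 7 baseC7 0 s s') = true := by
  decide +kernel

/-- Searches through all sets `P` of pairwise compatible classes among `7, …, 20`, checking `q`. -/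
def explore (q : List ℕ → Bool) : ℕ → List ℕ → Bool
  | 0, P => q P
  | k + 1, P => explore q k P && (P.any (classIncompatible (k + 7)) || explore q k ((k + 7) :: P))

/-- All classes in `P` are among the rotated classes in `L`. -/
def coveredBy (a : ℕ) (L P : List ℕ) : Bool :=
  P.all fun c => L.any fun l => Nat.beq (rotClass a l) c

/-- The classes in `P` and the classes `0, …, 6` contain all the rotated classes in `L`. -/
def contained (a : ℕ) (L P : List ℕ) : Bool :=
  L.all fun l => Nat.blt (rotClass a l) 7 || P.any fun c => Nat.beq (rotClass a l) c

/-- The classes of traces corresponding to the vertices of `M_0`. -/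
def classesM0 : List ℕ := [0, 1, 2, 3, 4, 5, 6, 7, 10, 14, 17, 18]

/-- The classes of traces corresponding to the vertices of `M_1`. -/
def classesM1 : List ℕ := [0, 1, 2, 3, 4, 5, 6, 7, 16]

/-- The classes of traces corresponding to the vertices of `M_2`. -/
def classesM2 : List ℕ := [0, 1, 2, 3, 4, 5, 6, 7, 16, 15]

/-- The classes of traces corresponding to the vertices of `M_3`. -/
def classesM3 : List ℕ := [0, 1, 2, 3, 4, 5, 6, 7, 16, 17]

lemma explore_C7 : explore (fun P => anyBelow 7 fun a => coveredBy a classesM0 P ||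
    [classesM1, classesM2, classesM3].any fun L => coveredBy a L P && contained a L P)
    14 [] = true := by
  decide +kernel

lemma trace_X : ∀ i < 7, maskC7 i < 2 ^ 7 ∧ ∀ j < 7, (maskC7 i).testBit j = baseC7 i j := by
  decide +kernel

lemma baseC7_iff : ∀ i j : Fin 7, baseC7 i j = true ↔ CAdj (cycleGraph 7) i j := by
  decide +kernel

lemma eq_of_cadj_C7 : ∀ i j : Fin 7, (∀ k, CAdj (cycleGraph 7) i k ↔ CAdj (cycleGraph 7) j k) →
    i = j := by
  decide +kernel

lemma maskC7_ne : ∀ k < 21, maskC7 k ≠ 127 := by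
  decide +kernel

lemma maskC7_inj : ∀ k < 21, ∀ l < 21, maskC7 k = maskC7 l → k = l := by
  decide +kernel

instance : DecidableRel M0.Adj := fun a b => decidable_of_iff _ (fromRel_adj _ a b).symm

instance : DecidableRel M1.Adj := fun a b => decidable_of_iff _ (fromRel_adj _ a b).symm

instance : DecidableRel M2.Adj := fun a b => decidable_of_iff _ (fromRel_adj _ a b).symm

instance : DecidableRel M3.Adj := fun a b => decidable_of_iff _ (fromRel_adj _ a b).symm

instance : DecidableRel T0.Adj := fun a b => decidable_of_iff _ (fromRel_adj _ a b).symm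

instance : DecidableRel T1.Adj := fun a b => decidable_of_iff _ (fromRel_adj _ a b).symm

/-- Under every rotation, the classes in the list `L` are pairwise different and have
the same adjacencies as the vertices of `M`, and they include the classes `0, …, 6`. -/
def Models {k : ℕ} (M : SimpleGraph (Fin k)) [DecidableRel M.Adj] (L : List ℕ) : Prop :=
  L.length = k ∧ (∀ l ∈ L, l < 21) ∧ ∀ a < 7,
    (∀ i j : Fin k, classAdj (rotClass a (L.getD i 0)) (rotClass a (L.getD j 0)) =
      decide (CAdj M i j)) ∧
    (∀ i j : Fin k, rotClass a (L.getD i 0) = rotClass a (L.getD j 0) → i = j) ∧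
    ∀ c < 7, ∃ l ∈ L, rotClass a l = c

instance {k : ℕ} (M : SimpleGraph (Fin k)) [DecidableRel M.Adj] (L : List ℕ) :
    Decidable (Models M L) :=
  inferInstanceAs (Decidable (_ ∧ _ ∧ _))

lemma models_M0 : Models M0 classesM0 := by decide +kernel

lemma models_M1 : Models M1 classesM1 := by decide +kernel

lemma models_M2 : Models M2 classesM2 := by decide +kernel

lemma models_M3 : Models M3 classesM3 := by decide +kernel

lemma rotClass_M0 : ∀ a < 7, ∀ i : Fin 12, i < 7 → rotClass a (classesM0.getD i 0) < 7 := by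
  decide +kernel

lemma explore_sound {q : List ℕ → Bool} {p : ℕ → Prop}
    (hp : ∀ x y, x < 21 → y < 21 → p x → p y → classIncompatible x y = false) (k : ℕ)
    (P : List ℕ) (hk : k ≤ 14) (h : explore q k P = true)
    (hP : ∀ x, x ∈ P ↔ k + 7 ≤ x ∧ x < 21 ∧ p x) :
    ∃ P', q P' = true ∧ ∀ x, x ∈ P' ↔ 7 ≤ x ∧ x < 21 ∧ p x := by
  induction k generalizing P with
  | zero => exact ⟨P, h, by simpa using hP⟩
  | succ k ih =>
    simp only [explore, Bool.and_eq_true, Bool.or_eq_true, List.any_eq_true] at h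
    by_cases hpk : p (k + 7)
    · rcases h.2 with ⟨x, hx, hx'⟩ | h'
      · have := (hP x).1 hx
        simp [hp _ _ (by omega) this.2.1 hpk this.2.2] at hx'
      · refine ih _ (by omega) h' fun x => ?_
        rw [List.mem_cons, hP]
        constructor
        · rintro (rfl | ⟨h₁, h₂⟩)
          · exact ⟨le_rfl, by omega, hpk⟩
          · exact ⟨by omega, h₂⟩
        · rintro ⟨h₁, h₂⟩
          rcases h₁.eq_or_lt with rfl | h₁
          · exact Or.inl rfl
          · exact Or.inr ⟨by omega, h₂⟩
    · refine ih _ (by omega) h.1 fun x => ?_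
      rw [hP]
      constructor
      · rintro ⟨h₁, h₂⟩
        exact ⟨by omega, h₂⟩
      · rintro ⟨h₁, h₂⟩
        rcases h₁.eq_or_lt with rfl | h₁
        · exact absurd h₂.2 hpk
        · exact ⟨by omega, h₂⟩

lemma rotClass_lt {a l : ℕ} (hl : l < 21) : rotClass a l < 21 := by
  simp only [rotClass]
  omega

section ForwardC7

variable {V : Type*} {G : SimpleGraph V} {f : ℕ → V} {t : V → ℕ}

lemma Frame.trace_C7 (F : Frame G 7 baseC7 f t) (v : V) :
    t v = 0 ∨ t v = 127 ∨ ∃ k < 21, t v = maskC7 k := by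
  have h := Paper2P3.trace_C7
  simp only [allBelow_iff, Bool.or_eq_true, Nat.beq_eq, anyBelow_iff] at h
  rcases h _ (F.trace_lt v) with h | h | h | h
  · exact Or.inl h
  · exact Or.inr (Or.inl h)
  · exact Or.inr (Or.inr h)
  · exact absurd h (F.not_excluded_self v)

lemma Frame.exists_isThickening_C7 (F : Frame G 7 baseC7 f t) {k : ℕ} {M : SimpleGraph (Fin k)}
    [DecidableRel M.Adj] {L : List ℕ} (hM : Models M L) {a : ℕ} (ha : a < 7)
    (hcov : ∀ v, t v = 127 ∨ ∃ l ∈ L, t v = maskC7 (rotClass a l)) :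
    ∃ S : Set V, IsThickening (G.induce S)
      (M.induce {j : Fin k | ∃ v, t v = maskC7 (rotClass a (L.getD j 0))}) ∧
      G.IsClique Sᶜ ∧ Complete G Sᶜ S := by
  obtain ⟨hk, hL, hM⟩ := hM
  obtain ⟨hadj, hinj, -⟩ := hM a ha
  have hlt : ∀ j : Fin k, rotClass a (L.getD j 0) < 21 := by
    intro j
    have hj : (j : ℕ) < L.length := hk ▸ j.2
    rw [List.getD_eq_getElem _ _ hj]
    exact rotClass_lt (hL _ (List.getElem_mem hj))
  have hcov' : ∀ v, t v = 127 ∨ ∃ j : Fin k, t v = maskC7 (rotClass a (L.getD j 0)) := by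
    intro v
    refine (hcov v).imp_right ?_
    rintro ⟨l, hl, h⟩
    obtain ⟨j, hj, rfl⟩ := List.mem_iff_getElem.1 hl
    refine ⟨⟨j, hk ▸ hj⟩, ?_⟩
    rw [h]
    simp only
    rw [List.getD_eq_getElem _ _ hj]
  refine F.exists_isThickening (full := 127) hcov' (fun j => maskC7_ne _ (hlt j)) ?_ ?_ ?_
  · intro i j hij
    exact hinj i j (maskC7_inj _ (hlt i) _ (hlt j) hij)
  · intro i j
    have h := classAdj_C7
    simp only [allBelow_iff] at h
    rw [← hadj]
    exact h _ (hlt i) _ (hlt j)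
  · intro v
    have h := full_C7
    simp only [List.all_eq_true] at h
    refine h _ ?_
    rcases hcov' v with h | ⟨j, h⟩
    · simp [h]
    · rw [h]
      exact List.mem_cons_of_mem _ (List.mem_map_of_mem (List.mem_range.2 (hlt j)))

lemma isThickeningOfM_of_C7 [Finite V] (hG : ¬ Forbidden (CAdj G))
    (hC : ContainsInduced G (cycleGraph 7)) (hs : ∀ v, ¬ IsSimplicial G v) :
    ∃ S : Set V, IsThickeningOfM (G.induce S) ∧ G.IsClique Sᶜ ∧ Complete G Sᶜ S := by
  obtain ⟨w, hw⟩ := (containsInduced_iff eq_of_cadj_C7).1 hC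
  obtain ⟨f, t, F⟩ := exists_frame hG baseC7_iff hw (w 0)
  have h0 : ∀ v, t v ≠ 0 := by
    intro v hv
    have hL : ∀ v, t v = 0 ∨ t v ∈ 127 :: (List.range 21).map maskC7 := by
      intro v
      rcases F.trace_C7 v with h | h | ⟨k, hk, h⟩
      · exact Or.inl h
      · simp [h]
      · rw [h]
        exact Or.inr (List.mem_cons_of_mem _ (List.mem_map_of_mem (List.mem_range.2 hk)))
    obtain ⟨u, hu⟩ := F.exists_isSimplicial ⟨v, hv⟩ hL (fun a b c ha hb hc =>
      F.cadj_trans_of_trace_zero (i := 0) (j := 1) (k := 2) (by decide) (by decide)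
        (by decide) (by decide) (by decide) (by decide) ha hb hc) closesUp_C7
    exact hs u hu
  have htr : ∀ v, t v = 127 ∨ ∃ k < 21, t v = maskC7 k :=
    fun v => (F.trace_C7 v).resolve_left (h0 v)
  have hX : ∀ c < 7, ∃ v, t v = maskC7 c := fun c hc =>
    ⟨f c, F.trace_base hc (trace_X c hc).1 (trace_X c hc).2⟩
  have hcomp : ∀ x y, x < 21 → y < 21 → (∃ v, t v = maskC7 x) → (∃ v, t v = maskC7 y) →
      classIncompatible x y = false := by
    rintro x y hx hy ⟨u, hu⟩ ⟨v, hv⟩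
    by_contra hxy
    have h₁ := classAdj_C7
    have h₂ := classIncompatible_C7
    simp only [allBelow_iff] at h₁ h₂
    replace h₁ := h₁ x hx y hy
    replace h₂ := h₂ x hx y hy
    simp only [Bool.or_eq_true, Bool.not_eq_true', hxy, false_or] at h₂
    rw [← hu, ← hv] at h₁ h₂
    cases h : classAdj x y <;> rw [h] at h₁ h₂
    · exact F.not_cadj_of_excluded h₁ (F.cadj_of_excluded h₂)
    · exact F.not_cadj_of_excluded h₂ (F.cadj_of_excluded h₁)
  obtain ⟨P, hq, hP⟩ := explore_sound hcomp 14 [] le_rfl explore_C7 (by simp; omega)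
  have cover : ∀ {k : ℕ} {M : SimpleGraph (Fin k)} [DecidableRel M.Adj] {L : List ℕ} {a : ℕ},
      Models M L → a < 7 → coveredBy a L P = true →
      ∀ v, t v = 127 ∨ ∃ l ∈ L, t v = maskC7 (rotClass a l) := by
    intro k M _ L a hM ha hc v
    refine (htr v).imp_right ?_
    rintro ⟨c, hc', hv⟩
    simp only [coveredBy, List.all_eq_true, List.any_eq_true, Nat.beq_eq] at hc
    have : ∃ l ∈ L, rotClass a l = c := by
      by_cases hc7 : c < 7
      · exact (hM.2.2 a ha).2.2 c hc7
      · exact hc c ((hP c).2 ⟨by omega, hc', v, hv⟩)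
    obtain ⟨l, hl, rfl⟩ := this
    exact ⟨l, hl, hv⟩
  have of_contained : ∀ {k : ℕ} {M : SimpleGraph (Fin k)} [DecidableRel M.Adj] {L : List ℕ}
      {a : ℕ}, Models M L → a < 7 → coveredBy a L P = true → contained a L P = true →
      ∃ S : Set V, IsThickening (G.induce S) M ∧ G.IsClique Sᶜ ∧ Complete G Sᶜ S := by
    intro k M _ L a hM ha hc hc'
    obtain ⟨S, hS, hS'⟩ := F.exists_isThickening_C7 hM ha (cover hM ha hc)
    refine ⟨S, hS.of_forall_mem fun j => ?_, hS'⟩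
    simp only [contained, List.all_eq_true, List.any_eq_true, Nat.beq_eq, Bool.or_eq_true,
      Nat.blt_eq] at hc'
    have hj : (j : ℕ) < L.length := hM.1 ▸ j.2
    show ∃ v, t v = _
    rw [List.getD_eq_getElem _ _ hj]
    rcases hc' _ (List.getElem_mem hj) with h | ⟨c, hc, h⟩
    · exact hX _ h
    · rw [h]
      exact ((hP c).1 hc).2.2
  simp only [anyBelow_iff, Bool.or_eq_true, List.any_cons, List.any_nil, Bool.and_eq_true,
    Bool.false_eq_true, or_false] at hq
  obtain ⟨a, ha, h | h | h | h⟩ := hq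
  · obtain ⟨S, hS, hS'⟩ := F.exists_isThickening_C7 models_M0 ha (cover models_M0 ha h)
    refine ⟨S, Or.inr (Or.inr (Or.inr ⟨_, ?_, by rwa [compl_compl]⟩)), hS'⟩
    intro j hj
    by_contra hj'
    refine hj (hX _ (rotClass_M0 a ha j ?_))
    revert hj'
    simp only [M0Extra, Set.mem_insert_iff, Set.mem_singleton_iff]
    clear hj
    revert j
    decide
  · obtain ⟨S, hS, hS'⟩ := of_contained models_M1 ha h.1 h.2
    exact ⟨S, Or.inl hS, hS'⟩
  · obtain ⟨S, hS, hS'⟩ := of_contained models_M2 ha h.1 h.2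
    exact ⟨S, Or.inr (Or.inl hS), hS'⟩
  · obtain ⟨S, hS, hS'⟩ := of_contained models_M3 ha h.1 h.2
    exact ⟨S, Or.inr (Or.inr (Or.inl hS)), hS'⟩

end ForwardC7

/-! ### Computations for `T_0` -/

/-- The closed adjacency matrix of `T_0`. -/
def baseT0 (i j : ℕ) : Bool := Nat.testBit 2271023853274608671422007 (9 * i + j)

/-- The traces on `T_0` of its own vertices. -/
def masksT0 : List ℕ := [55, 59, 69, 74, 147, 291, 460, 464, 480]

/-- The traces on `T_0` of the vertices of `T_1`. -/
def masksT1 : List ℕ := [55, 59, 69, 74, 147, 291, 460, 464, 480, 223]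

/-- The traces on `T_0` of the vertices of `T_1`, embedded differently. -/
def masksT1' : List ℕ := [55, 59, 69, 74, 291, 147, 460, 480, 464, 367]

/-- The traces on `T_0` that are proper, nonempty and do not come from simplicial vertices. -/
def tracesT0 : List ℕ := [55, 59, 69, 74, 147, 291, 460, 464, 480, 223, 367, 511]

lemma trace_T0 : allBelow 512 (fun m => Nat.beq m 0 || (Nat.beq m 384 ||
    (tracesT0.any (fun s => Nat.beq s m) || excluded 9 baseT0 m m true))) = true := by
  decide +kernel

lemma full_T0 : (tracesT0.all fun s => excluded 9 baseT0 511 s false) = true := by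
  decide +kernel

lemma closesUp_T0_zero : ((384 :: tracesT0).all fun s => excluded 9 baseT0 0 s true ||
    (384 :: tracesT0).all fun s' => closesUp 9 baseT0 0 s s') = true := by
  decide +kernel

lemma closesUp_T0 : (tracesT0.all fun s => excluded 9 baseT0 384 s true ||
    tracesT0.all fun s' => closesUp 9 baseT0 384 s s') = true := by
  decide +kernel

lemma clique_T0 : excluded 9 baseT0 384 384 false = true := by
  decide +kernel

lemma incompatible_T0 :
    (excluded 9 baseT0 223 367 false && excluded 9 baseT0 223 367 true) = true := by
  decide +kernel

lemma base_T0 : ∀ i < 9, masksT0.getD i 0 < 2 ^ 9 ∧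
    ∀ j < 9, (masksT0.getD i 0).testBit j = baseT0 i j := by
  decide +kernel

lemma baseT0_iff : ∀ i j : Fin 9, baseT0 i j = true ↔ CAdj T0 i j := by
  decide +kernel

lemma eq_of_cadj_T0 : ∀ i j : Fin 9, (∀ k, CAdj T0 i k ↔ CAdj T0 j k) → i = j := by
  decide +kernel

lemma excluded_T0 : ∀ i j : Fin 9, excluded 9 baseT0 (masksT0.getD i 0) (masksT0.getD j 0)
    (!decide (CAdj T0 i j)) = true := by
  decide +kernel

lemma excluded_T1 : ∀ i j : Fin 10, excluded 9 baseT0 (masksT1.getD i 0) (masksT1.getD j 0)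
    (!decide (CAdj T1 i j)) = true := by
  decide +kernel

lemma excluded_T1' : ∀ i j : Fin 10, excluded 9 baseT0 (masksT1'.getD i 0) (masksT1'.getD j 0)
    (!decide (CAdj T1 i j)) = true := by
  decide +kernel

section ForwardT0

variable {V : Type*} {G : SimpleGraph V} {f : ℕ → V} {t : V → ℕ}

lemma Frame.exists_isThickening_T0 (F : Frame G 9 baseT0 f t) {k : ℕ} {M : SimpleGraph (Fin k)}
    [DecidableRel M.Adj] {L : List ℕ} (hk : L.length = k) (hnd : L.Nodup) (hfull : 511 ∉ L)
    (hadj : ∀ i j : Fin k,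
      excluded 9 baseT0 (L.getD i 0) (L.getD j 0) (!decide (CAdj M i j)) = true)
    (htr : ∀ v, t v ∈ tracesT0) (hcov : ∀ v, t v = 511 ∨ t v ∈ L) (hL : ∀ l ∈ L, ∃ v, t v = l) :
    ∃ S : Set V, IsThickening (G.induce S) M ∧ G.IsClique Sᶜ ∧ Complete G Sᶜ S := by
  have hget : ∀ j : Fin k, ∃ h : (j : ℕ) < L.length, L.getD j 0 = L[(j : ℕ)] := fun j =>
    ⟨hk ▸ j.2, List.getD_eq_getElem _ _ _⟩
  have hmem : ∀ j : Fin k, L.getD j 0 ∈ L := by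
    intro j
    obtain ⟨h, e⟩ := hget j
    rw [e]
    exact List.getElem_mem h
  have hlab : ∀ v, t v = 511 ∨ ∃ j : Fin k, t v = L.getD j 0 := by
    intro v
    refine (hcov v).imp_right fun h => ?_
    obtain ⟨j, hj, e⟩ := List.mem_iff_getElem.1 h
    exact ⟨⟨j, hk ▸ hj⟩, by simp [hj, e]⟩
  have hinj : Function.Injective fun j : Fin k => L.getD j 0 := by
    intro i j hij
    obtain ⟨hi, ei⟩ := hget i
    obtain ⟨hj, ej⟩ := hget j
    simp only [ei, ej, hnd.getElem_inj_iff] at hij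
    exact Fin.ext hij
  have h := full_T0
  rw [List.all_eq_true] at h
  obtain ⟨S, hS, hS'⟩ := F.exists_isThickening hlab (fun j hj => hfull (hj ▸ hmem j)) hinj hadj
    fun v => h _ (htr v)
  exact ⟨S, hS.of_forall_mem fun j => hL _ (hmem j), hS'⟩

lemma isThickening_of_T0 [Finite V] (hG : ¬ Forbidden (CAdj G)) (hC : ContainsInduced G T0)
    (hs : ∀ v, ¬ IsSimplicial G v) : ∃ S : Set V,
      (IsThickening (G.induce S) T0 ∨ IsThickening (G.induce S) T1) ∧
      G.IsClique Sᶜ ∧ Complete G Sᶜ S := by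
  obtain ⟨w, hw⟩ := (containsInduced_iff eq_of_cadj_T0).1 hC
  obtain ⟨f, t, F⟩ := exists_frame hG baseT0_iff hw (w 0)
  have htr : ∀ v, t v = 0 ∨ t v ∈ 384 :: tracesT0 := by
    intro v
    have h := trace_T0
    simp only [allBelow_iff, Bool.or_eq_true, Nat.beq_eq, List.any_eq_true] at h
    rcases h _ (F.trace_lt v) with h | h | ⟨s, hs, h⟩ | h
    · exact Or.inl h
    · simp [h]
    · rw [← h]
      exact Or.inr (List.mem_cons_of_mem _ hs)
    · exact absurd h (F.not_excluded_self v)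
  have h0 : ∀ v, t v ≠ 0 := by
    intro v hv
    obtain ⟨u, hu⟩ := F.exists_isSimplicial ⟨v, hv⟩ htr (fun a b c ha hb hc =>
      F.cadj_trans_of_trace_zero (i := 2) (j := 0) (k := 1) (by decide) (by decide)
        (by decide) (by decide) (by decide) (by decide) ha hb hc) closesUp_T0_zero
    exact hs u hu
  replace htr : ∀ v, t v = 384 ∨ t v ∈ tracesT0 := fun v =>
    List.mem_cons.1 ((htr v).resolve_left (h0 v))
  have hY : ∀ v, t v ≠ 384 := by
    intro v hv
    obtain ⟨u, hu⟩ := F.exists_isSimplicial ⟨v, hv⟩ htr (fun a b c ha hb hc _ _ =>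
      F.cadj_of_excluded (by rw [ha, hc]; exact clique_T0)) closesUp_T0
    exact hs u hu
  replace htr : ∀ v, t v ∈ tracesT0 := fun v => (htr v).resolve_left (hY v)
  have hbase : ∀ l ∈ masksT0, ∃ v, t v = l := by
    intro l hl
    obtain ⟨i, hi, rfl⟩ := List.mem_iff_getElem.1 hl
    obtain ⟨h₁, h₂⟩ := base_T0 i hi
    rw [List.getD_eq_getElem _ _ hi] at h₁ h₂
    exact ⟨f i, F.trace_base hi h₁ h₂⟩
  by_cases h₁ : ∃ v, t v = 223
  · have h₂ : ∀ v, t v ≠ 367 := by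
      intro v hv
      obtain ⟨u, hu⟩ := h₁
      have h := incompatible_T0
      rw [Bool.and_eq_true, ← hu, ← hv] at h
      exact F.not_cadj_of_excluded h.2 (F.cadj_of_excluded h.1)
    have hcov : ∀ v, t v = 511 ∨ t v ∈ masksT1 := by
      intro v
      have := htr v
      have := h₂ v
      simp only [tracesT0, masksT1, List.mem_cons, List.not_mem_nil, or_false] at *
      tauto
    have hL : ∀ l ∈ masksT1, ∃ v, t v = l := by
      intro l hl
      simp only [masksT0, masksT1, List.mem_cons, List.not_mem_nil, or_false] at hbase hl
      rcases hl with rfl | rfl | rfl | rfl | rfl | rfl | rfl | rfl | rfl | rfl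
      on_goal 10 => exact h₁
      all_goals exact hbase _ (by simp)
    obtain ⟨S, hS, hS'⟩ := F.exists_isThickening_T0 (k := 10) (L := masksT1) rfl (by decide)
      (by decide) excluded_T1 htr hcov hL
    exact ⟨S, Or.inr hS, hS'⟩
  by_cases h₂ : ∃ v, t v = 367
  · have hcov : ∀ v, t v = 511 ∨ t v ∈ masksT1' := by
      intro v
      have := htr v
      have := not_exists.1 h₁ v
      simp only [tracesT0, masksT1', List.mem_cons, List.not_mem_nil, or_false] at *
      tauto
    have hL : ∀ l ∈ masksT1', ∃ v, t v = l := by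
      intro l hl
      simp only [masksT0, masksT1', List.mem_cons, List.not_mem_nil, or_false] at hbase hl
      rcases hl with rfl | rfl | rfl | rfl | rfl | rfl | rfl | rfl | rfl | rfl
      on_goal 10 => exact h₂
      all_goals exact hbase _ (by simp)
    obtain ⟨S, hS, hS'⟩ := F.exists_isThickening_T0 (k := 10) (L := masksT1') rfl (by decide)
      (by decide) excluded_T1' htr hcov hL
    exact ⟨S, Or.inr hS, hS'⟩
  have hcov : ∀ v, t v = 511 ∨ t v ∈ masksT0 := by
    intro v
    have := htr v
    have := not_exists.1 h₁ v
    have := not_exists.1 h₂ v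
    simp only [tracesT0, masksT0, List.mem_cons, List.not_mem_nil, or_false] at *
    tauto
  obtain ⟨S, hS, hS'⟩ := F.exists_isThickening_T0 (k := 9) (L := masksT0) rfl (by decide)
    (by decide) excluded_T0 htr hcov hbase
  exact ⟨S, Or.inl hS, hS'⟩

end ForwardT0

/-! ### Thickenings of the graphs in the family -/

section Backward

variable {V : Type*} {G : SimpleGraph V} {S : Set V}

/-- The conditions on a closed adjacency matrix on `k + 1` vertices, the last one of which is
universal, which make `properties_of_isThickening` applicable. -/
def Certifies (k n : ℕ) (B : ℕ → ℕ → Bool) : Bool :=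
  allBelow (k + 1) (fun i => B i k && B k i) && (!forbiddenB (k + 1) B &&
    allBelow (k + 1) fun i => anyBelow n fun j => anyBelow n fun l => B i j && (B i l && !B j l))

lemma properties_of_certifies {α : Type*} {M : SimpleGraph α} {e : α → ℕ} {k n : ℕ}
    {B : ℕ → ℕ → Bool} {H : SimpleGraph (Fin n)} (hc : Certifies k n B = true)
    (he : ∀ a, e a < k) (hB : ∀ a b, B (e a) (e b) = true ↔ CAdj M a b)
    (hrep : ∀ i : Fin n, ∃ a, e a = i) (hH : ∀ i j : Fin n, B i j = true ↔ CAdj H i j)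
    (hH' : ∀ i j, (∀ k, CAdj H i k ↔ CAdj H j k) → i = j)
    (hS : IsThickening (G.induce S) M) (hcl : G.IsClique Sᶜ) (hco : Complete G Sᶜ S) :
    ¬ Forbidden (CAdj G) ∧ ContainsInduced G H ∧ ∀ v, ¬ IsSimplicial G v := by
  simp only [Certifies, Bool.and_eq_true, Bool.not_eq_true'] at hc
  exact properties_of_isThickening he hB hc.1 hrep hc.2.1 hH hH' hc.2.2 hS hcl hco

lemma properties_of_certifies_fin {k n : ℕ} {M : SimpleGraph (Fin k)} {B : ℕ → ℕ → Bool}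
    {H : SimpleGraph (Fin n)} (hc : Certifies k n B = true) (hn : n ≤ k)
    (hB : ∀ a b : Fin k, B a b = true ↔ CAdj M a b)
    (hH : ∀ i j : Fin n, B i j = true ↔ CAdj H i j)
    (hH' : ∀ i j, (∀ k, CAdj H i k ↔ CAdj H j k) → i = j)
    (hS : IsThickening (G.induce S) M) (hcl : G.IsClique Sᶜ) (hco : Complete G Sᶜ S) :
    ¬ Forbidden (CAdj G) ∧ ContainsInduced G H ∧ ∀ v, ¬ IsSimplicial G v :=
  properties_of_certifies (e := fun a : Fin k => a) hc (fun a => a.2) hB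
    (fun i => ⟨i.castLE hn, rfl⟩) hH hH' hS hcl hco

/-- The closed adjacency matrix of `M_0` with a universal vertex. -/
def matrixM0 (i j : ℕ) : Bool :=
  Nat.testBit 748288704500768373325422388501937879033124492476355 (13 * i + j)

/-- The closed adjacency matrix of `M_1` with a universal vertex. -/
def matrixM1 (i j : ℕ) : Bool := Nat.testBit 1267491801028187264213223874243 (10 * i + j)

/-- The closed adjacency matrix of `M_2` with a universal vertex. -/
def matrixM2 (i j : ℕ) : Bool := Nat.testBit 2658414752327732474535909335864982723 (11 * i + j)

/-- The closed adjacency matrix of `M_3` with a universal vertex. -/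
def matrixM3 (i j : ℕ) : Bool := Nat.testBit 2658452148020476986235116443622719171 (11 * i + j)

/-- The closed adjacency matrix of `T_0` with a universal vertex. -/
def matrixT0 (i j : ℕ) : Bool := Nat.testBit 1267613067980968078867579858487 (10 * i + j)

/-- The closed adjacency matrix of `T_1` with a universal vertex. -/
def matrixT1 (i j : ℕ) : Bool := Nat.testBit 2658273281825932319077912565335055927 (11 * i + j)

lemma certifies_M0 : Certifies 12 7 matrixM0 = true := by decide +kernel

lemma certifies_M1 : Certifies 9 7 matrixM1 = true := by decide +kernel

lemma certifies_M2 : Certifies 10 7 matrixM2 = true := by decide +kernel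

lemma certifies_M3 : Certifies 10 7 matrixM3 = true := by decide +kernel

lemma certifies_T0 : Certifies 9 9 matrixT0 = true := by decide +kernel

lemma certifies_T1 : Certifies 10 9 matrixT1 = true := by decide +kernel

lemma matrixM0_iff : ∀ i j : Fin 12, matrixM0 i j = true ↔ CAdj M0 i j := by decide +kernel

lemma matrixM1_iff : ∀ i j : Fin 9, matrixM1 i j = true ↔ CAdj M1 i j := by decide +kernel

lemma matrixM2_iff : ∀ i j : Fin 10, matrixM2 i j = true ↔ CAdj M2 i j := by decide +kernel

lemma matrixM3_iff : ∀ i j : Fin 10, matrixM3 i j = true ↔ CAdj M3 i j := by decide +kernel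

lemma matrixT0_iff : ∀ i j : Fin 9, matrixT0 i j = true ↔ CAdj T0 i j := by decide +kernel

lemma matrixT1_iff : ∀ i j : Fin 10, matrixT1 i j = true ↔ CAdj T1 i j := by decide +kernel

lemma matrixM0_base : ∀ i j : Fin 7, matrixM0 i j = true ↔ CAdj (cycleGraph 7) i j := by
  decide +kernel

lemma matrixM1_base : ∀ i j : Fin 7, matrixM1 i j = true ↔ CAdj (cycleGraph 7) i j := by
  decide +kernel

lemma matrixM2_base : ∀ i j : Fin 7, matrixM2 i j = true ↔ CAdj (cycleGraph 7) i j := by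
  decide +kernel

lemma matrixM3_base : ∀ i j : Fin 7, matrixM3 i j = true ↔ CAdj (cycleGraph 7) i j := by
  decide +kernel

lemma matrixT0_base : ∀ i j : Fin 9, matrixT0 i j = true ↔ CAdj T0 i j := by
  decide +kernel

lemma matrixT1_base : ∀ i j : Fin 9, matrixT1 i j = true ↔ CAdj T0 i j := by
  decide +kernel

lemma properties_of_M0 {D : Set (Fin 12)} (hD : D ⊆ M0Extra)
    (hS : IsThickening (G.induce S) (M0.induce Dᶜ)) (hcl : G.IsClique Sᶜ)
    (hco : Complete G Sᶜ S) :
    ¬ Forbidden (CAdj G) ∧ ContainsInduced G (cycleGraph 7) ∧ ∀ v, ¬ IsSimplicial G v := by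
  refine properties_of_certifies (e := fun a => (a.1 : ℕ)) certifies_M0 (fun a => a.1.2) ?_ ?_
    matrixM0_base eq_of_cadj_C7 hS hcl hco
  · rintro ⟨a, ha⟩ ⟨b, hb⟩
    simp [matrixM0_iff, CAdj]
  · intro i
    refine ⟨⟨i.castLE (by decide), fun h => ?_⟩, rfl⟩
    have := hD h
    simp only [M0Extra, Set.mem_insert_iff, Set.mem_singleton_iff] at this
    revert this
    clear h
    revert i
    decide

end Backward

/-- A graph is `(2P_3,C_4,C_6)`-free, contains an induced `C_7` or an induced `T_0`,
and contains no simplicial vertices, if and only if it can be obtained from a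
thickening of a graph in `ℳ ∪ {T_0,T_1}` by possibly adding universal vertices. -/
theorem statement13 {V : Type*} [Fintype V] (G : SimpleGraph V) :
    (HFree G twoP3 ∧ HFree G (cycleGraph 4) ∧ HFree G (cycleGraph 6) ∧
      (ContainsInduced G (cycleGraph 7) ∨ ContainsInduced G T0) ∧
      (∀ v : V, ¬ IsSimplicial G v)) ↔
    (∃ S : Set V,
      (IsThickeningOfM (G.induce S) ∨ IsThickening (G.induce S) T0 ∨
        IsThickening (G.induce S) T1) ∧
      G.IsClique Sᶜ ∧ Complete G Sᶜ S) := by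
  have h : (¬ Forbidden (CAdj G) ∧ (ContainsInduced G (cycleGraph 7) ∨ ContainsInduced G T0) ∧
      ∀ v : V, ¬ IsSimplicial G v) ↔ (∃ S : Set V,
      (IsThickeningOfM (G.induce S) ∨ IsThickening (G.induce S) T0 ∨
        IsThickening (G.induce S) T1) ∧ G.IsClique Sᶜ ∧ Complete G Sᶜ S) := by
    constructor
    · rintro ⟨hG, hC | hC, hs⟩
      · obtain ⟨S, hS, hS'⟩ := isThickeningOfM_of_C7 hG hC hs
        exact ⟨S, Or.inl hS, hS'⟩
      · obtain ⟨S, hS, hS'⟩ := isThickening_of_T0 hG hC hs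
        exact ⟨S, Or.inr hS, hS'⟩
    · rintro ⟨S, (hS | hS | hS | ⟨D, hD, hS⟩) | hS | hS, hcl, hco⟩
      · exact (properties_of_certifies_fin certifies_M1 (by decide) matrixM1_iff matrixM1_base
          eq_of_cadj_C7 hS hcl hco).imp_right (And.imp_left Or.inl)
      · exact (properties_of_certifies_fin certifies_M2 (by decide) matrixM2_iff matrixM2_base
          eq_of_cadj_C7 hS hcl hco).imp_right (And.imp_left Or.inl)
      · exact (properties_of_certifies_fin certifies_M3 (by decide) matrixM3_iff matrixM3_base
          eq_of_cadj_C7 hS hcl hco).imp_right (And.imp_left Or.inl)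
      · exact (properties_of_M0 hD hS hcl hco).imp_right (And.imp_left Or.inl)
      · exact (properties_of_certifies_fin certifies_T0 (by decide) matrixT0_iff matrixT0_base
          eq_of_cadj_T0 hS hcl hco).imp_right (And.imp_left Or.inr)
      · exact (properties_of_certifies_fin certifies_T1 (by decide) matrixT1_iff matrixT1_base
          eq_of_cadj_T0 hS hcl hco).imp_right (And.imp_left Or.inr)
  rw [← h, not_forbidden_iff]
  tauto

end Paper2P3
end

section
/- Every (2P_3,C_4)-free graph that admits a clique-cutset contains a simplicial vertex. -/
open SimpleGraph

namespace Paper2P3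

variable {V : Type*}

theorem containsInduced_of_embedding {V W : Type*} {G : SimpleGraph V} {H : SimpleGraph W}
    (f : H ↪g G) : ContainsInduced G H :=
  ⟨Set.range f, ⟨⟨Equiv.ofInjective f f.injective, by intro a b; exact f.map_rel_iff⟩⟩⟩

theorem containsInduced_of_forall_lt {V : Type*} {G : SimpleGraph V} {n : ℕ}
    {H : SimpleGraph (Fin n)} (f : Fin n → V)
    (h : ∀ i j, i < j → f i ≠ f j ∧ (H.Adj i j ↔ G.Adj (f i) (f j))) : ContainsInduced G H := by
  refine containsInduced_of_embedding ⟨⟨f, fun i j hij => ?_⟩, fun {i j} => ?_⟩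
  · rcases lt_trichotomy i j with hlt | heq | hlt
    · exact absurd hij (h i j hlt).1
    · exact heq
    · exact absurd hij.symm (h j i hlt).1
  · rcases lt_trichotomy i j with hlt | rfl | hlt
    · exact (h i j hlt).2.symm
    · simp
    · rw [G.adj_comm, H.adj_comm]
      exact (h j i hlt).2.symm

/-- Three vertices inducing a path `a - b - c`. -/
def IsInducedP3 {V : Type*} (G : SimpleGraph V) (a b c : V) : Prop :=
  G.Adj a b ∧ G.Adj b c ∧ a ≠ c ∧ ¬ G.Adj a c

theorem not_anticomplete_of_twoP3_free {V : Type*} {G : SimpleGraph V} (h : HFree G twoP3)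
    {a b c d e f : V} (habc : IsInducedP3 G a b c) (hdef : IsInducedP3 G d e f)
    (hdisj : Disjoint ({a, b, c} : Set V) {d, e, f}) :
    ¬ Anticomplete G {a, b, c} {d, e, f} := by
  intro hanti
  obtain ⟨hab, hbc, hac, hac'⟩ := habc
  obtain ⟨hde, hef, hdf, hdf'⟩ := hdef
  simp only [Anticomplete, Set.mem_insert_iff, Set.mem_singleton_iff, forall_eq_or_imp,
    forall_eq] at hanti
  simp only [Set.disjoint_left, Set.mem_insert_iff, Set.mem_singleton_iff, forall_eq_or_imp,
    forall_eq, not_or] at hdisj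
  refine h (containsInduced_of_forall_lt ![a, b, c, d, e, f] fun i j hij => ?_)
  fin_cases i <;> fin_cases j <;> first
    | exact absurd hij (by decide)
    | simp [twoP3, hab, hbc, hde, hef, hab.ne, hbc.ne, hde.ne, hef.ne, hac, hac', hdf, hdf',
        hdisj, hanti]

theorem adj_or_adj_of_C4_free {V : Type*} {G : SimpleGraph V} (h : HFree G (cycleGraph 4))
    {a b c d : V} (hab : G.Adj a b) (hbc : G.Adj b c) (hcd : G.Adj c d) (hda : G.Adj d a)
    (hac : a ≠ c) (hbd : b ≠ d) : G.Adj a c ∨ G.Adj b d := by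
  by_contra! hn
  obtain ⟨hac', hbd'⟩ := hn
  refine h (containsInduced_of_forall_lt ![a, b, c, d] fun i j hij => ?_)
  fin_cases i <;> fin_cases j <;> first
    | exact absurd hij (by decide)
    | simp [cycleGraph_adj, hab, hbc, hcd, hda.symm, hab.ne, hbc.ne, hcd.ne, hda.ne', hac, hbd,
        hac', hbd'] <;> decide

/-- Every component of a graph is a clique or contains an induced `P_3`. -/
theorem isClique_setOf_reachable_or_exists_inducedP3 {V : Type*} (G : SimpleGraph V) (u : V) :
    G.IsClique {w | G.Reachable u w} ∨
      ∃ a b c, G.Reachable u a ∧ IsInducedP3 G a b c := by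
  by_contra! hn
  obtain ⟨hclique, hP3⟩ := hn
  refine hclique fun x hx y hy hxy => ?_
  have hreach : G.Reachable x y := hx.symm.trans hy
  rw [reachable_iff_reflTransGen] at hreach
  have key : x = y ∨ G.Adj x y := by
    clear hxy hy
    induction hreach with
    | refl => exact .inl rfl
    | @tail b c _ hbc ih =>
      rcases ih with rfl | hxb
      · exact .inr hbc
      · by_contra! hxc
        exact hP3 x b c hx ⟨hxb, hbc, hxc.1, hxc.2⟩
  exact key.resolve_left hxy

/-- A clique whose outside neighbors lie in a clique contains a simplicial vertex,
if it is nonempty and the graph is `C_4`-free. -/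
theorem exists_isSimplicial_of_isClique {V : Type*} [Finite V] {G : SimpleGraph V}
    (hC4 : HFree G (cycleGraph 4)) {A C : Set V} (hA : G.IsClique A) (hC : G.IsClique C)
    (hne : A.Nonempty) (hdisj : Disjoint A C) (hN : ∀ a ∈ A, G.neighborSet a ⊆ A ∪ C) :
    ∃ v, IsSimplicial G v := by
  obtain ⟨a, haA, hmin⟩ := A.toFinite.exists_minimalFor (fun a => G.neighborSet a ∩ C) A hne
  have key : ∀ b ∈ A, ∀ c ∈ C, G.Adj a c → b ≠ a → G.Adj b c := by
    intro b hb c hc hac hba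
    by_contra hbc
    refine hbc (hmin hb ?_ ⟨hac, hc⟩).1
    rintro d ⟨hbd, hd⟩
    refine ⟨?_, hd⟩
    rw [mem_neighborSet] at hbd ⊢
    by_contra had
    have hcd : c ≠ d := fun h => had (h ▸ hac)
    rcases adj_or_adj_of_C4_free hC4 hac (hC hc hd hcd) hbd.symm (hA hb haA hba)
      (fun h => Set.disjoint_left.1 hdisj haA (h ▸ hd))
      (fun h => Set.disjoint_left.1 hdisj hb (h ▸ hc)) with h | h
    · exact had h
    · exact hbc h.symm
  refine ⟨a, fun x hx y hy hxy => ?_⟩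
  rcases hN a haA hx with hxA | hxC <;> rcases hN a haA hy with hyA | hyC
  · exact hA hxA hyA hxy
  · exact key x hxA y hyC hy (G.ne_of_adj hx).symm
  · exact (key y hyA x hxC hx (G.ne_of_adj hy).symm).symm
  · exact hC hxC hyC hxy

/-- If a component of `G - C` is a clique, for a clique `C`, then it has a simplicial vertex. -/
theorem exists_isSimplicial_of_isClique_component {V : Type*} [Finite V] {G : SimpleGraph V}
    (hC4 : HFree G (cycleGraph 4)) {C : Set V} (hC : G.IsClique C) (u : (Cᶜ : Set V))
    (h : (G.induce Cᶜ).IsClique {w | (G.induce Cᶜ).Reachable u w}) :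
    ∃ v, IsSimplicial G v := by
  refine exists_isSimplicial_of_isClique hC4
    (A := Subtype.val '' {w | (G.induce Cᶜ).Reachable u w}) ?_ hC
    ⟨u, u, Reachable.refl u, rfl⟩ ?_ ?_
  · rintro _ ⟨x, hx, rfl⟩ _ ⟨y, hy, rfl⟩ hxy
    exact h hx hy fun e => hxy (congrArg _ e)
  · rw [Set.disjoint_left]
    rintro _ ⟨x, -, rfl⟩
    exact x.2
  · rintro _ ⟨x, hx, rfl⟩ y hy
    by_cases hyC : y ∈ C
    · exact .inr hyC
    · have hxy : (G.induce Cᶜ).Adj x ⟨y, hyC⟩ := hy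
      exact .inl ⟨⟨y, hyC⟩, Reachable.trans hx hxy.reachable, rfl⟩

theorem IsInducedP3.reachable {V : Type*} {G : SimpleGraph V} {u a b c : V}
    (h : IsInducedP3 G a b c) (hu : G.Reachable u a) :
    ∀ x ∈ ({a, b, c} : Set V), G.Reachable u x := by
  rintro x (rfl | rfl | rfl)
  · exact hu
  · exact hu.trans h.1.reachable
  · exact (hu.trans h.1.reachable).trans h.2.1.reachable

theorem HFree.induce {V W : Type*} {G : SimpleGraph V} {H : SimpleGraph W} (h : HFree G H)
    (s : Set V) : HFree (G.induce s) H := fun ⟨_, ⟨f⟩⟩ =>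
  h (containsInduced_of_embedding
    (((SimpleGraph.Embedding.induce s).comp (SimpleGraph.Embedding.induce _)).comp f.toEmbedding))

/-- Every `(2P_3,C_4)`-free graph that admits a clique-cutset contains a simplicial
vertex. -/
theorem statement14 {V : Type*} [Fintype V] (G : SimpleGraph V)
    (h2P3 : HFree G twoP3) (hC4 : HFree G (cycleGraph 4))
    (hcut : HasCliqueCutset G) :
    ∃ v : V, IsSimplicial G v := by
  obtain ⟨C, hC, hCne, hconn⟩ := hcut
  have : Nonempty (Cᶜ : Set V) := (Set.nonempty_compl.2 hCne).to_subtype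
  have hpre : ¬ (G.induce Cᶜ).Preconnected := fun h => hconn ⟨h⟩
  simp only [Preconnected, not_forall] at hpre
  obtain ⟨u, v, huv⟩ := hpre
  rcases isClique_setOf_reachable_or_exists_inducedP3 (G.induce Cᶜ) u with
    hu | ⟨a, b, c, hua, habc⟩
  · exact exists_isSimplicial_of_isClique_component hC4 hC u hu
  rcases isClique_setOf_reachable_or_exists_inducedP3 (G.induce Cᶜ) v with
    hv | ⟨d, e, f, hvd, hdef⟩
  · exact exists_isSimplicial_of_isClique_component hC4 hC v hv
  refine absurd ?_ (not_anticomplete_of_twoP3_free (h2P3.induce Cᶜ) habc hdef ?_)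
  · intro x hx y hy hxy
    exact huv (((habc.reachable hua x hx).trans hxy.reachable).trans
      (hdef.reachable hvd y hy).symm)
  · exact Set.disjoint_left.2 fun x hx hy =>
      huv ((habc.reachable hua x hx).trans (hdef.reachable hvd x hy).symm)

end Paper2P3
end

section
/- Let G be a C_4-free graph and let X and Y be disjoint cliques in G. Then for all x,x' ∈ X, one of the sets N_G(x) ∩ Y and N_G(x') ∩ Y is a subset of the other; consequently, X can be ordered as X = {x_1,…,x_{|X|}} so that N_G(x_{|X|}) ∩ Y ⊆ … ⊆ N_G(x_1) ∩ Y. -/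
open SimpleGraph

namespace Paper2P3

variable {V : Type*}

theorem HFree.not_inducedFourCycle {G : SimpleGraph V} (hC4 : HFree G (cycleGraph 4))
    {a b c d : V} (hab : G.Adj a b) (hbc : G.Adj b c) (hcd : G.Adj c d) (hda : G.Adj d a)
    (hac : a ≠ c) (hbd : b ≠ d) (nac : ¬ G.Adj a c) (nbd : ¬ G.Adj b d) : False := by
  have adj_iff : ∀ i j : Fin 4,
      G.Adj (![a, b, c, d] i) (![a, b, c, d] j) ↔ (cycleGraph 4).Adj i j := by
    intro i j
    fin_cases i <;> fin_cases j <;>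
      simp [cycleGraph_adj, hab, hbc, hcd, hda, nac, nbd, hab.symm, hbc.symm, hcd.symm,
        hda.symm, G.adj_comm c a, G.adj_comm d b] <;> decide
  have inj : Function.Injective ![a, b, c, d] := by
    intro i j hij
    fin_cases i <;> fin_cases j <;>
      simp_all [hab.ne, hbc.ne, hcd.ne, hda.ne, hab.ne', hbc.ne', hcd.ne', hda.ne',
        hac.symm, hbd.symm]
  exact hC4 ⟨Set.range ![a, b, c, d],
    ⟨⟨Equiv.ofInjective _ inj, fun {i j} => adj_iff i j⟩⟩⟩

theorem HFree.neighborSet_inter_subset_or_subset {G : SimpleGraph V}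
    (hC4 : HFree G (cycleGraph 4)) {X Y : Set V} (hX : G.IsClique X) (hY : G.IsClique Y)
    (hdisj : Disjoint X Y) {x x' : V} (hx : x ∈ X) (hx' : x' ∈ X) :
    G.neighborSet x ∩ Y ⊆ G.neighborSet x' ∩ Y ∨
      G.neighborSet x' ∩ Y ⊆ G.neighborSet x ∩ Y := by
  by_contra! h
  obtain ⟨y, ⟨hxy, hy⟩, hx'y⟩ := Set.not_subset.mp h.1
  obtain ⟨y', ⟨hx'y', hy'⟩, hxy'⟩ := Set.not_subset.mp h.2
  replace hx'y : ¬ G.Adj x' y := fun e => hx'y ⟨e, hy⟩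
  replace hxy' : ¬ G.Adj x y' := fun e => hxy' ⟨e, hy'⟩
  rw [mem_neighborSet] at hxy hx'y'
  have hxx' : x ≠ x' := by rintro rfl; exact hx'y hxy
  have hyy' : y ≠ y' := by rintro rfl; exact hxy' hxy
  exact hC4.not_inducedFourCycle hxy (hY hy hy' hyy') hx'y'.symm (hX hx' hx hxx'.symm)
    (hdisj.ne_of_mem hx hy') (hdisj.ne_of_mem hx' hy).symm hxy' fun e => hx'y e.symm

/-- A finite set on which `f` takes pairwise comparable finite values can be enumerated
so that `f` is decreasing. -/
theorem exists_equiv_fin_antitone {α β : Type*} {s : Finset α} {f : α → Set β}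
    (hfin : ∀ a ∈ s, (f a).Finite) (hf : ∀ a ∈ s, ∀ b ∈ s, f a ⊆ f b ∨ f b ⊆ f a) :
    ∃ e : Fin s.card ≃ {a // a ∈ s}, Antitone fun i => f (e i) := by
  let g : Fin s.card → ℕᵒᵈ := fun i => OrderDual.toDual (f (s.equivFin.symm i)).ncard
  refine ⟨(Tuple.sort g).trans s.equivFin.symm, fun i j hij => ?_⟩
  have hle : (f (s.equivFin.symm (Tuple.sort g j))).ncard ≤
      (f (s.equivFin.symm (Tuple.sort g i))).ncard := Tuple.monotone_sort g hij
  rcases hf _ (s.equivFin.symm (Tuple.sort g i)).2 _ (s.equivFin.symm (Tuple.sort g j)).2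
    with h | h
  · exact (Set.eq_of_subset_of_ncard_le h hle (hfin _ (Subtype.prop _))).ge
  · exact h

/-- In a `C_4`-free graph, the neighborhoods in a clique `Y` of the vertices of a
disjoint clique `X` are totally ordered by inclusion; consequently `X` can be ordered
as `x_1, …, x_{|X|}` with `N_G(x_{|X|}) ∩ Y ⊆ ⋯ ⊆ N_G(x_1) ∩ Y`. -/
theorem statement15 {V : Type*} [Fintype V] [DecidableEq V] (G : SimpleGraph V)
    (hC4 : HFree G (cycleGraph 4)) (X Y : Finset V)
    (hX : G.IsClique (X : Set V)) (hY : G.IsClique (Y : Set V))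
    (hdisj : Disjoint X Y) :
    (∀ x ∈ X, ∀ x' ∈ X,
      G.neighborSet x ∩ (Y : Set V) ⊆ G.neighborSet x' ∩ (Y : Set V) ∨
      G.neighborSet x' ∩ (Y : Set V) ⊆ G.neighborSet x ∩ (Y : Set V)) ∧
    (∃ e : Fin X.card ≃ {x // x ∈ X}, ∀ i j : Fin X.card, i ≤ j →
      G.neighborSet (e j : V) ∩ (Y : Set V) ⊆ G.neighborSet (e i : V) ∩ (Y : Set V)) := by
  have chain : ∀ x ∈ X, ∀ x' ∈ X,
      G.neighborSet x ∩ (Y : Set V) ⊆ G.neighborSet x' ∩ (Y : Set V) ∨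
      G.neighborSet x' ∩ (Y : Set V) ⊆ G.neighborSet x ∩ (Y : Set V) :=
    fun _ hx _ hx' => hC4.neighborSet_inter_subset_or_subset hX hY
      (Finset.disjoint_coe.mpr hdisj) hx hx'
  obtain ⟨e, he⟩ := exists_equiv_fin_antitone (fun _ _ => Set.toFinite _) chain
  exact ⟨chain, e, fun _ _ hij => he hij⟩

end Paper2P3
end

section
/- Let G be a graph and let X ⊊ V(G). Assume that for every x ∈ X, the set V(G) ∖ N_G[x] is either empty or can be partitioned into cliques of G pairwise anticomplete to each other. Then G is 2P_3-free if and only if G − X is 2P_3-free. -/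
open SimpleGraph

namespace Paper2P3

variable {V : Type*}

theorem containsInduced_iff_nonempty_embedding {V W : Type*} {G : SimpleGraph V}
    {H : SimpleGraph W} : ContainsInduced G H ↔ Nonempty (H ↪g G) :=
  isIndContained_iff_exists_iso_induce.symm

/-- In a disjoint union of pairwise anticomplete cliques, adjacency is transitive. -/
theorem CliquesPartition.adj_trans {V : Type*} {G : SimpleGraph V} {A : Set V}
    (hA : CliquesPartition G A) {a b c : V} (ha : a ∈ A) (hb : b ∈ A) (hc : c ∈ A)
    (hac : a ≠ c) (hab : G.Adj a b) (hbc : G.Adj b c) : G.Adj a c := by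
  obtain ⟨ℓ, P, hclique, -, hanti, rfl⟩ := hA
  obtain ⟨i, hi⟩ := Set.mem_iUnion.1 ha
  obtain ⟨j, hj⟩ := Set.mem_iUnion.1 hb
  obtain ⟨k, hk⟩ := Set.mem_iUnion.1 hc
  have hij : i = j := by
    by_contra hne
    exact hanti i j hne a hi b hj hab
  have hjk : j = k := by
    by_contra hne
    exact hanti j k hne b hj c hk hbc
  subst hij hjk
  exact hclique i hi hk hac

/-- The non-neighbors of any vertex of `2P_3` contain an induced `P_3`. -/
theorem twoP3_exists_inducedPath_compl_closedNbhd (i : Fin 6) :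
    ∃ a b c : Fin 6, a ∈ (closedNbhd twoP3 i)ᶜ ∧ b ∈ (closedNbhd twoP3 i)ᶜ ∧
      c ∈ (closedNbhd twoP3 i)ᶜ ∧ a ≠ c ∧ twoP3.Adj a b ∧ twoP3.Adj b c ∧
      ¬ twoP3.Adj a c := by
  by_cases hi : i < 3
  · refine ⟨3, 4, 5, ?_⟩
    fin_cases i <;> simp_all [closedNbhd, twoP3]
  · refine ⟨0, 1, 2, ?_⟩
    fin_cases i <;> simp_all [closedNbhd, twoP3]

theorem mem_closedNbhd_map_iff {V W : Type*} {G : SimpleGraph V} {H : SimpleGraph W}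
    (f : H ↪g G) {v w : W} : f w ∈ closedNbhd G (f v) ↔ w ∈ closedNbhd H v := by
  simp [closedNbhd]

/-- A vertex whose non-neighbors form a disjoint union of pairwise anticomplete cliques
lies in no induced `2P_3`. -/
theorem CliquesPartition.map_ne {V : Type*} {G : SimpleGraph V} {x : V}
    (hx : CliquesPartition G (closedNbhd G x)ᶜ) (f : twoP3 ↪g G) (i : Fin 6) : f i ≠ x := by
  rintro rfl
  obtain ⟨a, b, c, ha, hb, hc, hac, hab, hbc, hnac⟩ :=
    twoP3_exists_inducedPath_compl_closedNbhd i
  refine hnac (f.map_adj_iff.1 (hx.adj_trans ?_ ?_ ?_ (f.injective.ne hac)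
    (f.map_adj_iff.2 hab) (f.map_adj_iff.2 hbc))) <;>
  rwa [Set.mem_compl_iff, mem_closedNbhd_map_iff]

theorem cliquesPartition_empty {V : Type*} (G : SimpleGraph V) : CliquesPartition G ∅ :=
  ⟨0, Fin.elim0, fun i => i.elim0, fun i => i.elim0, fun i => i.elim0, by simp⟩

/-- If for every `x ∈ X ⊊ V(G)` the set `V(G) ∖ N_G[x]` is empty or can be
partitioned into cliques pairwise anticomplete to each other, then `G` is
`2P_3`-free if and only if `G - X` is `2P_3`-free. -/
theorem statement16 {V : Type*} [Fintype V] (G : SimpleGraph V) (X : Set V)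
    (hX : X ≠ Set.univ)
    (h : ∀ x ∈ X, (closedNbhd G x)ᶜ = ∅ ∨ CliquesPartition G (closedNbhd G x)ᶜ) :
    HFree G twoP3 ↔ HFree (G.induce Xᶜ) twoP3 := by
  rw [HFree, HFree, not_iff_not, containsInduced_iff_nonempty_embedding,
    containsInduced_iff_nonempty_embedding]
  constructor
  · rintro ⟨f⟩
    have hf : ∀ i, f i ∈ Xᶜ := fun i hi => by
      have hpart : CliquesPartition G (closedNbhd G (f i))ᶜ :=
        (h _ hi).elim (fun he => he ▸ cliquesPartition_empty G) id
      exact hpart.map_ne f i rfl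
    exact ⟨⟨⟨fun i => ⟨f i, hf i⟩, fun i j hij => f.injective (congrArg Subtype.val hij)⟩,
      f.map_adj_iff⟩⟩
  · rintro ⟨f⟩
    exact ⟨f.trans (SimpleGraph.Embedding.induce Xᶜ)⟩

end Paper2P3
end
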